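/- arXiv:2205.15287 — 4 statements merged into one kernel-verified Lean document; each statement's English description precedes it below -/
import Mathlib

section
/- Let V ⊆ ∂ be closed in C and fix o ∈ S. For every ε > 0 there exists an open set U ⊆ C with V ⊆ U such that 𝐏_o(ι(X_n) ∈ U for some n ≥ 0) ≤ 𝐏_o(X_∞ ∈ V) + ε. -/
open MeasureTheory Filter Topology

/-- If a sequence lying outside a closed set `V` enters every thickening of `V`, then its limit
belongs to `V`. -/
theorem mem_of_tendsto_of_forall_exists_mem_thickening {C : Type*} [PseudoMetricSpace C]
    {V : Set C} (hV : IsClosed V) {x : ℕ → C} {l : C} (hx : ∀ n, x n ∉ V)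
    (hl : Tendsto x atTop (𝓝 l)) {δ : ℕ → ℝ} (hδ : Tendsto δ atTop (𝓝 0))
    (hvisit : ∀ k, ∃ n, x n ∈ Metric.thickening (δ k) V) : l ∈ V := by
  by_contra hlV
  have hdisj : Disjoint (insert l (Set.range x)) V := by
    rw [Set.disjoint_left]
    rintro y (rfl | ⟨n, rfl⟩)
    exacts [hlV, hx n]
  obtain ⟨r, hr, hrdisj⟩ := hdisj.exists_thickenings hl.isCompact_insert_range hV
  obtain ⟨k, hk⟩ := (hδ.eventually_lt_const hr).exists
  obtain ⟨n, hn⟩ := hvisit k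
  exact Set.disjoint_left.1 hrdisj
    (Metric.self_subset_thickening hr _ (Set.mem_insert_of_mem _ ⟨n, rfl⟩))
    (Metric.thickening_mono hk.le V hn)

/-- Let `V ⊆ ∂ = C \ ι(S)` be closed. For every `ε > 0` there is an open
set `U ⊇ V` in `C` such that the probability (under the law `Q o` of the Markov chain
started at `o`) that the chain ever visits `U` is at most `𝐏ₒ(X_∞ ∈ V) + ε`. -/
theorem chain_hitting_open_neighbourhood
    {S : Type*} [Countable S] [DecidableEq S]
    (P : S → S → ℝ)
    (hP0 : ∀ x y, 0 ≤ P x y)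
    (hP1 : ∀ x, HasSum (fun y => P x y) 1)
    (o : S)
    {C : Type*} [TopologicalSpace C] [CompactSpace C]
    [TopologicalSpace.MetrizableSpace C] [MeasurableSpace C] [BorelSpace C]
    [TopologicalSpace S] [DiscreteTopology S]
    (ι : S → C) (hι : IsOpenEmbedding ι)
    [MeasurableSpace S] [MeasurableSingletonClass S]
    (Q : S → Measure (ℕ → S))
    (hQprob : ∀ x, IsProbabilityMeasure (Q x))
    (hQcyl : ∀ (x : S) (n : ℕ) (s : ℕ → S),
      Q x {ω | ∀ i ≤ n, ω i = s i} =
        (if s 0 = x then 1 else 0) *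
          ∏ i ∈ Finset.range n, ENNReal.ofReal (P (s i) (s (i + 1))))
    (Xinf : (ℕ → S) → C)
    (hXmeas : Measurable Xinf)
    (hXconv : ∀ x : S, ∀ᵐ ω ∂(Q x),
      Xinf ω ∈ (Set.range ι)ᶜ ∧ Tendsto (fun n => ι (ω n)) atTop (𝓝 (Xinf ω)))
    (V : Set C) (hVclosed : IsClosed V) (hVsub : V ⊆ (Set.range ι)ᶜ) :
    ∀ ε : ℝ, 0 < ε → ∃ U : Set C, IsOpen U ∧ V ⊆ U ∧
      Q o {ω | ∃ n : ℕ, ι (ω n) ∈ U} ≤ Q o (Xinf ⁻¹' V) + ENNReal.ofReal ε := by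
  intro ε hε
  let := TopologicalSpace.metrizableSpaceMetric C
  have := hQprob o
  let U : ℕ → Set C := fun k => Metric.thickening (1 / ((k : ℝ) + 1)) V
  let E : ℕ → Set (ℕ → S) := fun k => {ω | ∃ n : ℕ, ι (ω n) ∈ U k}
  have hEmeas : ∀ k, MeasurableSet (E k) := fun k => by
    simp only [E, Set.ofPred_exists]
    exact .iUnion fun n =>
      (Set.to_countable (ι ⁻¹' U k)).measurableSet.preimage (measurable_pi_apply n)
  have hEanti : Antitone E := fun j k hjk ω ⟨n, hn⟩ =>
    ⟨n, Metric.thickening_mono (Nat.one_div_le_one_div hjk) V hn⟩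
  have hlim : Tendsto (fun k => Q o (E k)) atTop (𝓝 (Q o (⋂ k, E k))) :=
    tendsto_measure_iInter_atTop (fun k => (hEmeas k).nullMeasurableSet) hEanti
      ⟨0, measure_ne_top _ _⟩
  have hle : Q o (⋂ k, E k) ≤ Q o (Xinf ⁻¹' V) := by
    apply measure_mono_ae
    filter_upwards [hXconv o] with ω hω hωE
    exact mem_of_tendsto_of_forall_exists_mem_thickening hVclosed
      (fun n hn => hVsub hn ⟨ω n, rfl⟩) hω.2 tendsto_one_div_add_atTop_nhds_zero_nat
      (Set.mem_iInter.1 hωE)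
  have hlt : Q o (⋂ k, E k) < Q o (Xinf ⁻¹' V) + ENNReal.ofReal ε :=
    hle.trans_lt (ENNReal.lt_add_right (measure_ne_top _ _) (ENNReal.ofReal_pos.2 hε).ne')
  obtain ⟨k, hk⟩ := (hlim.eventually_lt_const hlt).exists
  exact ⟨U k, Metric.isOpen_thickening,
    Metric.self_subset_thickening Nat.one_div_pos_of_nat V, hk.le⟩
end

section
/- Let A ⊆ ∂ be open in the subspace topology of ∂ and define h : S → [0,1] by h(x) := 𝐏_x(X_∞ ∈ A). Then almost surely the limit lim_{n→∞} ⟨h, B̄_n⟩ exists, and every subsequential weak limit W of the sequence of random finite measures (B̄_n)_{n≥0} on C satisfies W(A) = lim_{n→∞} ⟨h, B̄_n⟩. -/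
open MeasureTheory Filter Topology

/-- The (rescaled) branching random walk configuration `w : S → ℝ≥0∞`, viewed as a finite
measure on the compactification `C` via the embedding `ι`: the measure `∑ₓ w(x) δ_{ι(x)}`. -/
noncomputable def brwMeasure {S C : Type*} [MeasurableSpace C] (ι : S → C) (w : S → ENNReal) :
    MeasureTheory.Measure C :=
  MeasureTheory.Measure.sum fun x => w x • MeasureTheory.Measure.dirac (ι x)

/-- `W` is a subsequential weak limit of the sequence of finite measures `μs` on `C`:
along some strictly increasing subsequence, the integrals of every bounded continuous
function converge to the corresponding integral against `W`. -/
def IsSubseqWeakLimit {C : Type*} [TopologicalSpace C] [MeasurableSpace C]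
    (μs : ℕ → MeasureTheory.Measure C) (W : MeasureTheory.Measure C) : Prop :=
  ∃ φ : ℕ → ℕ, StrictMono φ ∧
    ∀ f : BoundedContinuousFunction C ℝ,
      Filter.Tendsto (fun k => ∫ c, f c ∂(μs (φ k))) Filter.atTop (nhds (∫ c, f c ∂W))
/-- A nonnegative process whose integrals over past events decrease (a supermartingale with values
in `ℝ≥0∞`) converges almost surely to a finite limit. -/
theorem ae_exists_tendsto_of_setLIntegral_succ_le {Ω : Type*} {mΩ : MeasurableSpace Ω}
    {μ : Measure Ω} [IsFiniteMeasure μ] {F : Filtration ℕ mΩ} {Z : ℕ → Ω → ENNReal}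
    (hadapt : ∀ n, Measurable[F n] (Z n)) (h0 : ∫⁻ ω, Z 0 ω ∂μ ≠ ⊤)
    (hle : ∀ n s, MeasurableSet[F n] s → ∫⁻ ω in s, Z (n + 1) ω ∂μ ≤ ∫⁻ ω in s, Z n ω ∂μ) :
    ∀ᵐ ω ∂μ, ∃ L : ENNReal, L ≠ ⊤ ∧ Tendsto (fun n => Z n ω) atTop (𝓝 L) := by
  have hmeas : ∀ n, Measurable (Z n) := fun n => (hadapt n).mono (F.le n) le_rfl
  have hbound : ∀ n, ∫⁻ ω, Z n ω ∂μ ≤ ∫⁻ ω, Z 0 ω ∂μ := by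
    intro n
    induction n with
    | zero => exact le_rfl
    | succ n ih =>
      have := hle n Set.univ MeasurableSet.univ
      simp only [Measure.restrict_univ] at this
      exact this.trans ih
  have hne : ∀ n, ∫⁻ ω, Z n ω ∂μ ≠ ⊤ := fun n => ne_top_of_le_ne_top h0 (hbound n)
  have hlt : ∀ n, ∀ᵐ ω ∂μ, Z n ω < ⊤ := fun n => ae_lt_top (hmeas n) (hne n)
  have hsub : Submartingale (fun n ω => -(Z n ω).toReal) F μ := by
    refine submartingale_of_setIntegral_le_succ ?_ ?_ ?_
    · intro n
      exact (@Measurable.ennreal_toReal _ (F n) _ (hadapt n)).neg.stronglyMeasurable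
    · intro n
      exact (integrable_toReal_of_lintegral_ne_top (hmeas n).aemeasurable (hne n)).neg
    · intro n s hs
      rw [integral_neg, integral_neg, neg_le_neg_iff,
        integral_toReal (hmeas _).aemeasurable (ae_restrict_of_ae (hlt _)),
        integral_toReal (hmeas _).aemeasurable (ae_restrict_of_ae (hlt _))]
      exact ENNReal.toReal_mono
        (ne_top_of_le_ne_top (hne n) (setLIntegral_le_lintegral _ _)) (hle n s hs)
  have hbdd : ∀ n, eLpNorm (fun ω => -(Z n ω).toReal) 1 μ ≤ (∫⁻ ω, Z 0 ω ∂μ).toNNReal := by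
    intro n
    rw [ENNReal.coe_toNNReal h0, eLpNorm_one_eq_lintegral_enorm]
    refine le_trans (lintegral_mono fun ω => ?_) (hbound n)
    rw [enorm_neg, Real.enorm_eq_ofReal ENNReal.toReal_nonneg]
    exact ENNReal.ofReal_toReal_le
  filter_upwards [hsub.exists_ae_tendsto_of_bdd hbdd, ae_all_iff.2 hlt] with ω ⟨c, hc⟩ hω
  refine ⟨ENNReal.ofReal (-c), ENNReal.ofReal_ne_top, ?_⟩
  refine (ENNReal.tendsto_ofReal hc.neg).congr fun n => ?_
  rw [neg_neg, ENNReal.ofReal_toReal (hω n).ne]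

/-- The one-step shift on trajectories. -/
def pathShift {S : Type*} (w : ℕ → S) : ℕ → S := fun n => w (n + 1)

theorem pathShift_iterate_apply {S : Type*} (w : ℕ → S) (n k : ℕ) :
    (pathShift^[n] w) k = w (k + n) := by
  induction n generalizing w with
  | zero => rfl
  | succ n ih => rw [Function.iterate_succ_apply, ih]; simp [pathShift, add_assoc]

theorem measurable_pathShift {S : Type*} [MeasurableSpace S] :
    Measurable (pathShift : (ℕ → S) → ℕ → S) :=
  measurable_pi_lambda _ fun n => measurable_pi_apply (n + 1)

/-- The family of laws `Q` on trajectories starts at the indicated point and has the Markov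
property with respect to the transition kernel `p`. -/
structure IsMarkovLaw {S : Type*} [MeasurableSpace S] (p : S → S → ENNReal)
    (Q : S → Measure (ℕ → S)) : Prop where
  start : ∀ x, ∀ᵐ w ∂Q x, w 0 = x
  shift : ∀ x E, MeasurableSet E → Q x (pathShift ⁻¹' E) = ∑' y, p x y * Q y E

/-- `b` is the normalised occupation process of a branching random walk driven by `p`, started
at `o`. -/
structure IsNormalizedBranching {S Ω : Type*} [DecidableEq S] {mΩ : MeasurableSpace Ω}
    (μ : Measure Ω) (F : Filtration ℕ mΩ) (p : S → S → ENNReal) (o : S)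
    (b : ℕ → Ω → S → ENNReal) : Prop where
  measurable : ∀ n x, Measurable[F n] (fun ω => b n ω x)
  zero : ∀ ω x, b 0 ω x = if x = o then 1 else 0
  tsum_ne_top : ∀ n ω, ∑' x, b n ω x ≠ ⊤
  setLIntegral_succ : ∀ n x s, MeasurableSet[F n] s →
    ∫⁻ ω in s, b (n + 1) ω x ∂μ = ∫⁻ ω in s, ∑' y, b n ω y * p y x ∂μ

/-- Cylinder sets generate the product σ-algebra on trajectories in a countable space. -/
theorem generateFrom_cylinder {S : Type*} [Countable S] [MeasurableSpace S]
    [MeasurableSingletonClass S] :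
    (MeasurableSpace.pi : MeasurableSpace (ℕ → S)) = MeasurableSpace.generateFrom
      {E | ∃ (n : ℕ) (s : ℕ → S), E = {w | ∀ i ≤ n, w i = s i}} := by
  apply le_antisymm
  · refine iSup_le fun i => ?_
    rintro _ ⟨T, -, rfl⟩
    have : (fun w : ℕ → S => w i) ⁻¹' T =
        ⋃ t : {t : Fin (i + 1) → S // t (Fin.last i) ∈ T},
          {w | ∀ j ≤ i, w j = t.1 (Fin.ofNat (i + 1) j)} := by
      ext w
      simp only [Set.mem_preimage, Set.mem_iUnion, Set.mem_ofPred_eq]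
      constructor
      · intro hw
        refine ⟨⟨fun j => w j, by simpa using hw⟩, fun j hj => ?_⟩
        simp [Nat.mod_eq_of_lt (Nat.lt_succ_of_le hj)]
      · rintro ⟨⟨t, ht⟩, h⟩
        rw [h i le_rfl]
        convert ht using 2
        ext
        simp
    rw [this]
    refine MeasurableSet.iUnion fun t => MeasurableSpace.measurableSet_generateFrom ?_
    exact ⟨i, fun j => t.1 (Fin.ofNat (i + 1) j), rfl⟩
  · refine MeasurableSpace.generateFrom_le ?_
    rintro _ ⟨n, s, rfl⟩
    have : {w : ℕ → S | ∀ i ≤ n, w i = s i} = ⋂ i, ⋂ (_ : i ≤ n), (fun w : ℕ → S => w i) ⁻¹' {s i} := by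
      ext w; simp
    rw [this]
    exact MeasurableSet.iInter fun i => MeasurableSet.iInter fun _ =>
      measurable_pi_apply i (measurableSet_singleton _)

theorem isPiSystem_cylinder {S : Type*} :
    IsPiSystem {E : Set (ℕ → S) | ∃ (n : ℕ) (s : ℕ → S), E = {w | ∀ i ≤ n, w i = s i}} := by
  rintro _ ⟨n, s, rfl⟩ _ ⟨k, t, rfl⟩ ⟨w, hw₁, hw₂⟩
  refine ⟨max n k, w, ?_⟩
  ext v
  simp only [Set.mem_inter_iff, Set.mem_ofPred_eq] at *
  constructor
  · rintro ⟨h₁, h₂⟩ i hi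
    rcases le_max_iff.1 hi with h | h
    · rw [h₁ i h, hw₁ i h]
    · rw [h₂ i h, hw₂ i h]
  · intro h
    exact ⟨fun i hi => by rw [h i (le_max_of_le_left hi), hw₁ i hi],
      fun i hi => by rw [h i (le_max_of_le_right hi), hw₂ i hi]⟩

/-- Laws with the cylinder probabilities of a Markov chain satisfy the Markov property. -/
theorem isMarkovLaw_of_cylinder {S : Type*} [Countable S] [DecidableEq S] [MeasurableSpace S]
    [MeasurableSingletonClass S] {p : S → S → ENNReal} (hp : ∀ x, ∑' y, p x y = 1)
    {Q : S → Measure (ℕ → S)} (hQ : ∀ x, IsProbabilityMeasure (Q x))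
    (hcyl : ∀ (x : S) (n : ℕ) (s : ℕ → S), Q x {w | ∀ i ≤ n, w i = s i} =
      (if s 0 = x then 1 else 0) * ∏ i ∈ Finset.range n, p (s i) (s (i + 1))) :
    IsMarkovLaw p Q := by
  have hstart : ∀ x, ∀ᵐ w ∂Q x, w 0 = x := by
    intro x
    have h := hcyl x 0 fun _ => x
    simp only [nonpos_iff_eq_zero, forall_eq, if_true, Finset.range_zero, Finset.prod_empty,
      mul_one] at h
    have hm : MeasurableSet {w : ℕ → S | w 0 = x} :=
      (measurable_pi_apply (X := fun _ => S) 0) (measurableSet_singleton x)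
    exact (prob_compl_eq_zero_iff hm).2 h
  refine ⟨hstart, fun x E hE => ?_⟩
  have key : (Q x).map pathShift = Measure.sum fun y => p x y • Q y := by
    refine ext_of_generate_finite _ generateFrom_cylinder isPiSystem_cylinder ?_ ?_
    · rintro _ ⟨n, s, rfl⟩
      have hms : MeasurableSet {w : ℕ → S | ∀ i ≤ n, w i = s i} := by
        rw [generateFrom_cylinder]
        exact MeasurableSpace.measurableSet_generateFrom ⟨n, s, rfl⟩
      rw [Measure.map_apply measurable_pathShift hms, Measure.sum_apply _ hms]
      have hae : (pathShift ⁻¹' {w : ℕ → S | ∀ i ≤ n, w i = s i} : Set (ℕ → S)) =ᵐ[Q x]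
          {w | ∀ i ≤ n + 1, w i = (Nat.rec x (fun k _ => s k) i : S)} := by
        filter_upwards [hstart x] with w hw
        apply propext
        change (∀ i ≤ n, w (i + 1) = s i) ↔ ∀ i ≤ n + 1, w i = (Nat.rec x (fun k _ => s k) i : S)
        constructor
        · rintro h (_ | i) hi
          · exact hw
          · exact h i (by omega)
        · intro h i hi
          exact h (i + 1) (by omega)
      rw [measure_congr hae, hcyl, Finset.prod_range_succ']
      simp only [Measure.smul_apply, smul_eq_mul, hcyl]
      rw [tsum_eq_single (s 0)]
      · simp [mul_comm]
      · intro y hy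
        simp [hy.symm]
    · rw [Measure.map_apply measurable_pathShift .univ, Measure.sum_apply _ .univ]
      simp [hp]
  have := congrArg (fun ν => ν E) key
  simpa [Measure.map_apply measurable_pathShift hE, Measure.sum_apply _ hE] using this

namespace IsMarkovLaw

variable {S : Type*} [Countable S] [MeasurableSpace S] {p : S → S → ENNReal}
  {Q : S → Measure (ℕ → S)}

theorem ae_pathShift (hQ : IsMarkovLaw p Q) {R : (ℕ → S) → Prop} (hR : ∀ x, ∀ᵐ w ∂Q x, R w)
    (x : S) : ∀ᵐ w ∂Q x, R (pathShift w) := by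
  choose! T hT hTm hT0 using fun x => exists_measurable_superset_of_null (hR x)
  have hm : MeasurableSet (⋂ x, T x) := MeasurableSet.iInter hTm
  refine measure_mono_null (t := pathShift ⁻¹' (⋂ x, T x)) ?_ ?_
  · intro w hw
    exact Set.mem_iInter.2 fun y => hT y hw
  · rw [hQ.shift x _ hm, ENNReal.tsum_eq_zero]
    intro y
    rw [measure_mono_null (Set.iInter_subset _ y) (hT0 y), mul_zero]

end IsMarkovLaw

namespace IsNormalizedBranching

variable {S Ω : Type*} [Countable S] [DecidableEq S] {mΩ : MeasurableSpace Ω}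
  {μ : Measure Ω} {F : Filtration ℕ mΩ} {p : S → S → ENNReal} {o : S}
  {b : ℕ → Ω → S → ENNReal}

theorem measurable_tsum (hb : IsNormalizedBranching μ F p o b) (f : S → ENNReal) (n : ℕ) :
    Measurable[F n] fun ω => ∑' x, f x * b n ω x := by
  have aux : ∀ m' : MeasurableSpace Ω, (∀ x, Measurable[m'] fun ω => b n ω x) →
      Measurable[m'] fun ω => ∑' x, f x * b n ω x :=
    fun _ h => Measurable.tsum fun x => (h x).const_mul (f x)
  exact aux (F n) (hb.measurable n)

variable [MeasurableSpace S] {Q : S → Measure (ℕ → S)}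

theorem setLIntegral_tsum_succ (hb : IsNormalizedBranching μ F p o b) (hQ : IsMarkovLaw p Q)
    {E : Set (ℕ → S)} (hE : MeasurableSet E) (n : ℕ) {s : Set Ω} (hs : MeasurableSet[F n] s) :
    ∫⁻ ω in s, ∑' x, Q x E * b (n + 1) ω x ∂μ =
      ∫⁻ ω in s, ∑' x, Q x (pathShift ⁻¹' E) * b n ω x ∂μ := by
  have hbm : ∀ n x, Measurable fun ω => b n ω x :=
    fun n x => (hb.measurable n x).mono (F.le n) le_rfl
  calc ∫⁻ ω in s, ∑' x, Q x E * b (n + 1) ω x ∂μ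
      = ∑' x, Q x E * ∫⁻ ω in s, ∑' y, b n ω y * p y x ∂μ := by
        rw [lintegral_tsum fun x => ((hbm _ x).const_mul _).aemeasurable]
        refine tsum_congr fun x => ?_
        rw [lintegral_const_mul _ (hbm _ x), hb.setLIntegral_succ n x s hs]
    _ = ∫⁻ ω in s, ∑' x, Q x E * ∑' y, b n ω y * p y x ∂μ := by
        have hm : ∀ x, Measurable fun ω => ∑' y, b n ω y * p y x :=
          fun x => Measurable.tsum fun y => (hbm n y).mul_const _
        rw [lintegral_tsum fun x => ((hm x).const_mul _).aemeasurable]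
        exact tsum_congr fun x => (lintegral_const_mul _ (hm x)).symm
    _ = _ := by
        refine lintegral_congr fun ω => ?_
        simp_rw [hQ.shift _ E hE, ← ENNReal.tsum_mul_left, ← ENNReal.tsum_mul_right]
        rw [ENNReal.tsum_comm]
        exact tsum_congr fun x => tsum_congr fun y => by ring

theorem lintegral_tsum_eq (hb : IsNormalizedBranching μ F p o b) (hQ : IsMarkovLaw p Q)
    [IsProbabilityMeasure μ] {E : Set (ℕ → S)} (hE : MeasurableSet E) (n : ℕ) :
    ∫⁻ ω, ∑' x, Q x E * b n ω x ∂μ = Q o (pathShift^[n] ⁻¹' E) := by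
  induction n generalizing E with
  | zero => simp [hb.zero]
  | succ n ih =>
    have h := hb.setLIntegral_tsum_succ hQ hE n (s := Set.univ) MeasurableSet.univ
    rw [Measure.restrict_univ] at h
    rw [h, ih (measurable_pathShift hE), Function.iterate_succ', Set.preimage_comp]

/-- Pairing the branching process with the probability of an event that only shrinks under the
shift gives an almost surely convergent sequence. -/
theorem ae_exists_tendsto (hb : IsNormalizedBranching μ F p o b) (hQ : IsMarkovLaw p Q)
    [IsProbabilityMeasure μ] [∀ x, IsProbabilityMeasure (Q x)] {E : Set (ℕ → S)}
    (hE : MeasurableSet E) (hshift : ∀ x, pathShift ⁻¹' E ≤ᵐ[Q x] E) :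
    ∀ᵐ ω ∂μ, ∃ L : ENNReal, L ≠ ⊤ ∧
      Tendsto (fun n => ∑' x, Q x E * b n ω x) atTop (𝓝 L) := by
  refine ae_exists_tendsto_of_setLIntegral_succ_le (F := F) (hb.measurable_tsum _) ?_ ?_
  · rw [hb.lintegral_tsum_eq hQ hE]
    exact measure_ne_top _ _
  · intro n s hs
    rw [hb.setLIntegral_tsum_succ hQ hE n hs]
    refine lintegral_mono fun ω => ENNReal.tsum_le_tsum fun x => ?_
    gcongr ?_ * _
    exact measure_mono_ae (hshift x)

end IsNormalizedBranching

section BoundaryLimit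

variable {S : Type*} [Countable S] [MeasurableSpace S] [MeasurableSingletonClass S]
  {p : S → S → ENNReal} {Q : S → Measure (ℕ → S)}
  {C : Type*} [TopologicalSpace C] [MeasurableSpace C] {ι : S → C} {Xinf : (ℕ → S) → C}

omit [MeasurableSingletonClass S] [MeasurableSpace C] in
theorem IsMarkovLaw.ae_limit_pathShift_iterate [T2Space C] (hQ : IsMarkovLaw p Q)
    (hX : ∀ x, ∀ᵐ w ∂Q x, Tendsto (fun n => ι (w n)) atTop (𝓝 (Xinf w))) (n : ℕ) (x : S) :
    ∀ᵐ w ∂Q x, Xinf (pathShift^[n] w) = Xinf w := by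
  have one : ∀ y, ∀ᵐ w ∂Q y, Xinf (pathShift w) = Xinf w := by
    intro y
    filter_upwards [hX y, hQ.ae_pathShift hX y] with w h₁ h₂
    exact tendsto_nhds_unique h₂ ((tendsto_add_atTop_iff_nat 1).2 h₁)
  induction n generalizing x with
  | zero => exact ae_of_all _ fun _ => rfl
  | succ n ih =>
    filter_upwards [one x, hQ.ae_pathShift ih x] with w h₁ h₂
    rw [Function.iterate_succ_apply, h₂, h₁]

/-- Trajectories that visit `V` but do not converge to a point of `D`. -/
def visitAvoid (ι : S → C) (Xinf : (ℕ → S) → C) (V D : Set C) : Set (ℕ → S) :=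
  {w | (∃ k, ι (w k) ∈ V) ∧ Xinf w ∉ D}

omit [MeasurableSpace S] [MeasurableSingletonClass S] [Countable S] [TopologicalSpace C]
  [MeasurableSpace C] in
theorem mem_preimage_visitAvoid_iff {V D : Set C} {w : ℕ → S} {n : ℕ}
    (hw : Xinf (pathShift^[n] w) = Xinf w) :
    w ∈ pathShift^[n] ⁻¹' visitAvoid ι Xinf V D ↔ (∃ k ≥ n, ι (w k) ∈ V) ∧ Xinf w ∉ D := by
  simp only [visitAvoid, Set.mem_preimage, Set.mem_ofPred_eq, hw, pathShift_iterate_apply]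
  refine and_congr_left fun _ => ⟨?_, ?_⟩
  · rintro ⟨k, hk⟩
    exact ⟨k + n, by omega, hk⟩
  · rintro ⟨k, hk, h⟩
    exact ⟨k - n, by rwa [Nat.sub_add_cancel hk]⟩

omit [TopologicalSpace C] [MeasurableSpace C] in
theorem measurableSet_exists_ge_mem (V : Set C) (n : ℕ) :
    MeasurableSet {w : ℕ → S | ∃ k ≥ n, ι (w k) ∈ V} := by
  have : {w : ℕ → S | ∃ k ≥ n, ι (w k) ∈ V} = ⋃ k, ⋃ (_ : k ≥ n), (fun w => w k) ⁻¹' (ι ⁻¹' V) := by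
    ext w; simp
  rw [this]
  exact MeasurableSet.iUnion fun k => MeasurableSet.iUnion fun _ =>
    measurable_pi_apply k (MeasurableSet.of_discrete)

omit [TopologicalSpace C] in
theorem measurableSet_visitAvoid (hXm : Measurable Xinf) (V : Set C) {D : Set C}
    (hD : MeasurableSet D) : MeasurableSet (visitAvoid ι Xinf V D) := by
  have h := measurableSet_exists_ge_mem (S := S) (ι := ι) V 0
  simp only [ge_iff_le, zero_le, true_and] at h
  exact h.inter (hXm hD.compl)

omit [MeasurableSingletonClass S] [MeasurableSpace C] in
theorem IsMarkovLaw.preimage_visitAvoid_le [T2Space C] (hQ : IsMarkovLaw p Q)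
    (hX : ∀ x, ∀ᵐ w ∂Q x, Tendsto (fun n => ι (w n)) atTop (𝓝 (Xinf w))) (V D : Set C) (x : S) :
    pathShift ⁻¹' visitAvoid ι Xinf V D ≤ᵐ[Q x] visitAvoid ι Xinf V D := by
  filter_upwards [hQ.ae_limit_pathShift_iterate hX 1 x] with w hw h
  obtain ⟨⟨k, -, hk⟩, hD⟩ := (mem_preimage_visitAvoid_iff (n := 1) hw).1 h
  exact ⟨⟨k, hk⟩, hD⟩

theorem IsMarkovLaw.liminf_preimage_visitAvoid_le [T2Space C] (hQ : IsMarkovLaw p Q)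
    [∀ x, IsProbabilityMeasure (Q x)] (hXm : Measurable Xinf)
    (hX : ∀ x, ∀ᵐ w ∂Q x, Tendsto (fun n => ι (w n)) atTop (𝓝 (Xinf w))) {V K D : Set C}
    (hVK : V ⊆ K) (hK : IsClosed K) (hD : MeasurableSet D) (o : S) :
    liminf (fun n => Q o (pathShift^[n] ⁻¹' visitAvoid ι Xinf V D)) atTop ≤
      Q o (Xinf ⁻¹' (K \ D)) := by
  set G : ℕ → Set (ℕ → S) := fun n => {w | (∃ k ≥ n, ι (w k) ∈ V)} ∩ Xinf ⁻¹' Dᶜ with hG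
  have hGm : ∀ n, MeasurableSet (G n) :=
    fun n => (measurableSet_exists_ge_mem V n).inter (hXm hD.compl)
  have hanti : Antitone G := by
    rintro n l hnl w ⟨⟨k, hk, h⟩, h'⟩
    exact ⟨⟨k, hnl.trans hk, h⟩, h'⟩
  have hlim := tendsto_measure_iInter_atTop (μ := Q o) (fun n => (hGm n).nullMeasurableSet) hanti
    ⟨0, measure_ne_top _ _⟩
  have heq : ∀ n, Q o (pathShift^[n] ⁻¹' visitAvoid ι Xinf V D) = Q o (G n) := by
    intro n
    refine measure_congr ?_
    filter_upwards [hQ.ae_limit_pathShift_iterate hX n o] with w hw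
    exact propext (mem_preimage_visitAvoid_iff hw)
  simp_rw [heq]
  refine (hlim.liminf_eq.le).trans (measure_mono_ae ?_)
  filter_upwards [hX o] with w hw hwG
  have hwG' := fun n => Set.mem_iInter.1 hwG n
  refine ⟨hK.mem_of_frequently_of_tendsto (frequently_atTop.2 fun n => ?_) hw, (hwG' 0).2⟩
  obtain ⟨k, hk, h⟩ := (hwG' n).1
  exact ⟨k, hk, hVK h⟩

omit [MeasurableSpace S] [MeasurableSingletonClass S] [TopologicalSpace C] [Countable S] in
theorem brwMeasure_apply (u : S → ENNReal) {V : Set C} (hV : MeasurableSet V) :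
    brwMeasure ι u V = ∑' x, u x * V.indicator 1 (ι x) := by
  simp [brwMeasure, Measure.sum_apply _ hV, Measure.dirac_apply' _ hV]

omit [MeasurableSpace S] [MeasurableSingletonClass S] [TopologicalSpace C] [Countable S] in
theorem brwMeasure_univ (u : S → ENNReal) : brwMeasure ι u Set.univ = ∑' x, u x := by
  simp [brwMeasure_apply u .univ]

omit [Countable S] [MeasurableSingletonClass S] [TopologicalSpace C] in
theorem IsMarkovLaw.brwMeasure_le (hQ : IsMarkovLaw p Q) [∀ x, IsProbabilityMeasure (Q x)]
    (u : S → ENNReal) {V : Set C} (hV : MeasurableSet V) (D : Set C) :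
    brwMeasure ι u V ≤
      ∑' x, Q x (Xinf ⁻¹' D) * u x + ∑' x, Q x (visitAvoid ι Xinf V D) * u x := by
  rw [brwMeasure_apply u hV, ← ENNReal.tsum_add]
  refine ENNReal.tsum_le_tsum fun x => ?_
  by_cases hx : ι x ∈ V
  · have h1 : 1 ≤ Q x (Xinf ⁻¹' D) + Q x (visitAvoid ι Xinf V D) := by
      refine le_trans ?_ (measure_union_le _ _)
      rw [← measure_univ (μ := Q x)]
      refine measure_mono_ae ?_
      filter_upwards [hQ.start x] with w hw _
      by_cases h : Xinf w ∈ D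
      · exact Or.inl h
      · exact Or.inr ⟨⟨0, by rwa [hw]⟩, h⟩
    rw [Set.indicator_of_mem hx, Pi.one_apply, ← add_mul, mul_comm]
    gcongr
  · simp [hx]

theorem IsSubseqWeakLimit.exists_tendsto [OpensMeasurableSpace C]
    {ν : ℕ → Measure C} {W : Measure C} (hν : ∀ n, IsFiniteMeasure (ν n)) [IsFiniteMeasure W]
    (h : IsSubseqWeakLimit ν W) : ∃ φ : ℕ → ℕ, StrictMono φ ∧
      ∀ f : BoundedContinuousFunction C NNReal,
        Tendsto (fun k => ∫⁻ c, f c ∂ν (φ k)) atTop (𝓝 (∫⁻ c, f c ∂W)) := by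
  obtain ⟨φ, hφ, h⟩ := h
  refine ⟨φ, hφ, ?_⟩
  let ν' : ℕ → FiniteMeasure C := fun k => ⟨ν (φ k), hν (φ k)⟩
  let W' : FiniteMeasure C := ⟨W, inferInstance⟩
  have h' : Tendsto ν' atTop (𝓝 W') := FiniteMeasure.tendsto_iff_forall_integral_tendsto.2 h
  exact FiniteMeasure.tendsto_iff_forall_lintegral_tendsto.1 h'

end BoundaryLimit

/-- Asymptotic bounds for the masses of an open thickening of `D` are inherited by the mass of `D`
under any subsequential weak limit. -/
theorem IsSubseqWeakLimit.measure_le {C : Type*} [PseudoEMetricSpace C] [MeasurableSpace C]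
    [OpensMeasurableSpace C] {ν : ℕ → Measure C} {W : Measure C}
    (hν : ∀ n, IsFiniteMeasure (ν n)) [IsFiniteMeasure W] (h : IsSubseqWeakLimit ν W)
    {D : Set C} (hD : MeasurableSet D) {δ : ℝ} (hδ : 0 < δ) {a : ℕ → ENNReal} {L : ENNReal}
    (ha : Tendsto a atTop (𝓝 L)) (hle : ∀ n, ν n (Metric.thickening δ D) ≤ a n) : W D ≤ L := by
  obtain ⟨φ, hφ, hf⟩ := h.exists_tendsto hν
  have h1 : W D ≤ ∫⁻ c, thickenedIndicator hδ D c ∂W := by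
    rw [← lintegral_indicator_one hD]
    refine lintegral_mono fun c => ?_
    by_cases hc : c ∈ D
    · simp [hc, thickenedIndicator_one hδ D hc]
    · simp [hc]
  refine h1.trans (le_of_tendsto_of_tendsto' (hf _) (ha.comp hφ.tendsto_atTop) fun k => ?_)
  refine le_trans ?_ (hle (φ k))
  rw [← lintegral_indicator_one Metric.isOpen_thickening.measurableSet]
  refine lintegral_mono fun c => ?_
  by_cases hc : c ∈ Metric.thickening δ D
  · simpa [hc] using thickenedIndicator_le_one hδ D c
  · simp [hc, thickenedIndicator_zero hδ D hc]

theorem IsSubseqWeakLimit.measure_univ_eq {C : Type*} [TopologicalSpace C] [MeasurableSpace C]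
    [OpensMeasurableSpace C] {ν : ℕ → Measure C} {W : Measure C}
    (hν : ∀ n, IsFiniteMeasure (ν n)) [IsFiniteMeasure W] (h : IsSubseqWeakLimit ν W)
    {L : ENNReal} (hL : Tendsto (fun n => ν n Set.univ) atTop (𝓝 L)) : W Set.univ = L := by
  obtain ⟨φ, hφ, hf⟩ := h.exists_tendsto hν
  refine tendsto_nhds_unique ?_ (hL.comp hφ.tendsto_atTop)
  simpa [Function.comp_def] using hf 1

section ClosedSets

variable {S Ω : Type*} [Countable S] [DecidableEq S] [MeasurableSpace S]
  [MeasurableSingletonClass S] {mΩ : MeasurableSpace Ω} {μ : Measure Ω} [IsProbabilityMeasure μ]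
  {F : Filtration ℕ mΩ} {p : S → S → ENNReal} {o : S} {b : ℕ → Ω → S → ENNReal}
  {Q : S → Measure (ℕ → S)} [∀ x, IsProbabilityMeasure (Q x)]
  {C : Type*} [TopologicalSpace C] [TopologicalSpace.MetrizableSpace C] [MeasurableSpace C]
  [BorelSpace C] {ι : S → C} {Xinf : (ℕ → S) → C}

omit [MeasurableSingletonClass S] [TopologicalSpace.MetrizableSpace C] [BorelSpace C] in
/-- The pairing of the branching process with a harmonic function of the form
`x ↦ Q x (X_∞ ∈ D)` converges almost surely. -/
theorem IsNormalizedBranching.ae_exists_tendsto_limit [T2Space C]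
    (hb : IsNormalizedBranching μ F p o b)
    (hQ : IsMarkovLaw p Q) (hXm : Measurable Xinf)
    (hX : ∀ x, ∀ᵐ w ∂Q x, Tendsto (fun n => ι (w n)) atTop (𝓝 (Xinf w)))
    {D : Set C} (hD : MeasurableSet D) :
    ∀ᵐ ω ∂μ, ∃ L : ENNReal, L ≠ ⊤ ∧
      Tendsto (fun n => ∑' x, Q x (Xinf ⁻¹' D) * b n ω x) atTop (𝓝 L) := by
  refine hb.ae_exists_tendsto hQ (hXm hD) fun x => ?_
  filter_upwards [hQ.ae_limit_pathShift_iterate hX 1 x] with w hw h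
  change Xinf w ∈ D
  rw [← hw]
  exact h

/-- Subsequential weak limits of the branching process charge a closed set at most as much as the
limit of the pairings with the corresponding harmonic function. -/
theorem IsNormalizedBranching.ae_closed_le (hb : IsNormalizedBranching μ F p o b)
    (hQ : IsMarkovLaw p Q) (hXm : Measurable Xinf)
    (hX : ∀ x, ∀ᵐ w ∂Q x, Tendsto (fun n => ι (w n)) atTop (𝓝 (Xinf w)))
    {D : Set C} (hD : IsClosed D) :
    ∀ᵐ ω ∂μ, ∃ L : ENNReal, L ≠ ⊤ ∧
      Tendsto (fun n => ∑' x, Q x (Xinf ⁻¹' D) * b n ω x) atTop (𝓝 L) ∧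
      ∀ W : Measure C, IsFiniteMeasure W →
        IsSubseqWeakLimit (fun n => brwMeasure ι (b n ω)) W → W D ≤ L := by
  let _ : MetricSpace C := TopologicalSpace.metrizableSpaceMetric C
  obtain ⟨δ, -, hδ, hδ0⟩ := exists_seq_strictAnti_tendsto (0 : ℝ)
  set E : ℕ → Set (ℕ → S) := fun j => visitAvoid ι Xinf (Metric.thickening (δ j) D) D with hE
  have hEm : ∀ j, MeasurableSet (E j) := fun j => measurableSet_visitAvoid hXm _ hD.measurableSet
  set M : ℕ → Ω → ENNReal := fun j ω => liminf (fun n => ∑' x, Q x (E j) * b n ω x) atTop with hM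
  have hZm : ∀ j n, Measurable fun ω => ∑' x, Q x (E j) * b n ω x :=
    fun j n => (hb.measurable_tsum (fun x => Q x (E j)) n).mono (F.le n) le_rfl
  have hMm : ∀ j, Measurable (M j) := fun j => Measurable.liminf (hZm j)
  have hMint : ∀ j, ∫⁻ ω, M j ω ∂μ ≤ Q o (Xinf ⁻¹' (Metric.cthickening (δ j) D \ D)) := by
    intro j
    refine (lintegral_liminf_le (hZm j)).trans ?_
    simp_rw [hb.lintegral_tsum_eq hQ (hEm j)]
    exact hQ.liminf_preimage_visitAvoid_le hXm hX (Metric.thickening_subset_cthickening _ _)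
      Metric.isClosed_cthickening hD.measurableSet o
  have hsmall : Tendsto (fun j => Q o (Xinf ⁻¹' (Metric.cthickening (δ j) D \ D))) atTop (𝓝 0) := by
    have h := (tendsto_measure_cthickening_of_isClosed
      (μ := ((Q o).map Xinf).restrict Dᶜ) ⟨1, one_pos, measure_ne_top _ _⟩ hD).comp hδ0
    rw [Measure.restrict_apply hD.measurableSet, Set.inter_compl_self, measure_empty] at h
    refine h.congr fun j => ?_
    have hc : MeasurableSet (Metric.cthickening (δ j) D) :=
      Metric.isClosed_cthickening.measurableSet
    rw [Function.comp_apply, Measure.restrict_apply hc,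
      Measure.map_apply hXm (hc.inter hD.measurableSet.compl), Set.sdiff_eq]
  have hinf : ∀ᵐ ω ∂μ, ⨅ j, M j ω = 0 := by
    refine (lintegral_eq_zero_iff (Measurable.iInf hMm)).1 (le_antisymm ?_ (zero_le))
    exact ge_of_tendsto' hsmall fun j =>
      (lintegral_mono fun ω => iInf_le _ j).trans (hMint j)
  have hconv : ∀ᵐ ω ∂μ, ∀ j, Tendsto (fun n => ∑' x, Q x (E j) * b n ω x) atTop (𝓝 (M j ω)) := by
    refine ae_all_iff.2 fun j => ?_
    filter_upwards [hb.ae_exists_tendsto hQ (hEm j) (hQ.preimage_visitAvoid_le hX _ _)] with ω hω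
    obtain ⟨L, -, hL⟩ := hω
    simpa only [hM, hL.liminf_eq] using hL
  filter_upwards [hb.ae_exists_tendsto_limit hQ hXm hX hD.measurableSet, hinf, hconv] with
    ω ⟨L, hLtop, hL⟩ h0 hc
  refine ⟨L, hLtop, hL, fun W _ hW => ?_⟩
  have hfin : ∀ n, IsFiniteMeasure (brwMeasure ι (b n ω)) := fun n =>
    ⟨by rw [brwMeasure_univ]; exact (hb.tsum_ne_top n ω).lt_top⟩
  rw [← add_zero L, ← h0, ENNReal.add_iInf]
  refine le_iInf fun j => ?_
  exact hW.measure_le hfin hD.measurableSet (hδ j) (hL.add (hc j)) fun n =>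
    hQ.brwMeasure_le (b n ω) Metric.isOpen_thickening.measurableSet D

end ClosedSets

/-- Normalising a branching random walk with mean offspring `m` by `m ^ n`. -/
theorem isNormalizedBranching_of_condExp {S Ω : Type*} [Countable S] [DecidableEq S]
    {P : S → S → ℝ} (hP0 : ∀ x y, 0 ≤ P x y) {m : ℝ} (hm : 0 < m) {o : S}
    {mΩ : MeasurableSpace Ω} {μ : Measure Ω} [IsFiniteMeasure μ] {F : Filtration ℕ mΩ}
    {B : ℕ → Ω → S → ℕ} (hadapt : ∀ n x, Measurable[F n] (fun ω => B n ω x))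
    (hfin : ∀ n ω, (Function.support (B n ω)).Finite)
    (hint : ∀ n x, Integrable (fun ω => (B n ω x : ℝ)) μ)
    (hB0 : ∀ ω x, B 0 ω x = if x = o then 1 else 0)
    (hbranch : ∀ n x, μ[fun ω => (B (n + 1) ω x : ℝ)|F n]
      =ᵐ[μ] fun ω => m * ∑' y, (B n ω y : ℝ) * P y x) :
    IsNormalizedBranching μ F (fun x y => ENNReal.ofReal (P x y)) o
      (fun n ω x => ENNReal.ofReal ((m ^ n)⁻¹ * (B n ω x : ℝ))) where
  measurable n x := by
    have h : Measurable fun k : ℕ => ENNReal.ofReal ((m ^ n)⁻¹ * (k : ℝ)) := measurable_from_nat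
    exact h.comp (hadapt n x)
  zero ω x := by
    rw [hB0]
    split_ifs <;> simp
  tsum_ne_top n ω := by
    rw [tsum_eq_sum (s := (hfin n ω).toFinset) fun x hx => ?_]
    · exact ENNReal.sum_ne_top.2 fun x _ => ENNReal.ofReal_ne_top
    · have : B n ω x = 0 := by simpa using hx
      simp [this]
  setLIntegral_succ n x s hs := by
    have hreal : ∫ ω in s, (m ^ (n + 1))⁻¹ * (B (n + 1) ω x : ℝ) ∂μ =
        ∫ ω in s, (m ^ n)⁻¹ * ∑' y, (B n ω y : ℝ) * P y x ∂μ := by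
      rw [integral_const_mul, ← setIntegral_condExp (F.le n) (hint (n + 1) x) hs,
        integral_congr_ae (ae_restrict_of_ae (hbranch n x)), ← integral_const_mul]
      refine integral_congr_ae (ae_of_all _ fun ω => ?_)
      change (m ^ (n + 1))⁻¹ * (m * _) = (m ^ n)⁻¹ * _
      rw [← mul_assoc]
      congr 1
      rw [pow_succ]
      field_simp
    have hint' : Integrable (fun ω => (m ^ n)⁻¹ * ∑' y, (B n ω y : ℝ) * P y x) μ := by
      have h := (integrable_condExp.congr (hbranch n x)).const_mul ((m ^ n)⁻¹ * m⁻¹)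
      refine h.congr (ae_of_all _ fun ω => ?_)
      change (m ^ n)⁻¹ * m⁻¹ * (m * _) = _
      field_simp
    have hnn : ∀ ω, 0 ≤ (m ^ n)⁻¹ * ∑' y, (B n ω y : ℝ) * P y x := fun ω =>
      mul_nonneg (by positivity) (tsum_nonneg fun y => mul_nonneg (Nat.cast_nonneg _) (hP0 y x))
    rw [← ofReal_integral_eq_lintegral_ofReal ((hint (n + 1) x).const_mul _).integrableOn
      (ae_of_all _ fun ω => by positivity), hreal,
      ofReal_integral_eq_lintegral_ofReal hint'.integrableOn (ae_of_all _ hnn)]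
    refine lintegral_congr fun ω => ?_
    have hnn' : ∀ y, 0 ≤ (m ^ n)⁻¹ * (B n ω y : ℝ) := fun y => by positivity
    rw [← tsum_mul_left, ENNReal.ofReal_tsum_of_nonneg]
    · refine tsum_congr fun y => ?_
      rw [← mul_assoc, ENNReal.ofReal_mul (hnn' y)]
    · intro y
      rw [← mul_assoc]
      exact mul_nonneg (hnn' y) (hP0 y x)
    · refine summable_of_hasFiniteSupport ((hfin n ω).subset fun y hy => ?_)
      intro h0
      exact hy (by simp [h0])


/-- Let `A ⊆ ∂` be open in the subspace topology of `∂` and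
`h(x) := 𝐏ₓ(X_∞ ∈ A)`. Almost surely the limit `limₙ ⟨h, B̄ₙ⟩` exists, and every
subsequential weak limit `W` of the random measures `B̄ₙ` on `C` satisfies
`W(A) = limₙ ⟨h, B̄ₙ⟩`. -/
theorem brw_relatively_open_set_mass
    {S : Type*} [Countable S] [DecidableEq S]
    (P : S → S → ℝ)
    (hP0 : ∀ x y, 0 ≤ P x y)
    (hP1 : ∀ x, HasSum (fun y => P x y) 1)
    (m : ℝ) (hm : 1 < m) (o : S)
    {Ω : Type*} {mΩ : MeasurableSpace Ω}
    (μ : Measure Ω) [IsProbabilityMeasure μ]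
    (F : Filtration ℕ mΩ)
    (B : ℕ → Ω → S → ℕ)
    (hadapt : ∀ n x, Measurable[F n] (fun ω => B n ω x))
    (hfin : ∀ n ω, (Function.support (B n ω)).Finite)
    (hint : ∀ n x, Integrable (fun ω => (B n ω x : ℝ)) μ)
    (hB0 : ∀ ω x, B 0 ω x = if x = o then 1 else 0)
    (hbranch : ∀ n x,
      μ[fun ω => (B (n + 1) ω x : ℝ)|F n]
        =ᵐ[μ] fun ω => m * ∑' y, (B n ω y : ℝ) * P y x)
    {C : Type*} [TopologicalSpace C] [CompactSpace C]
    [TopologicalSpace.MetrizableSpace C] [MeasurableSpace C] [BorelSpace C]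
    [TopologicalSpace S] [DiscreteTopology S]
    (ι : S → C) (hι : IsOpenEmbedding ι)
    [MeasurableSpace S] [MeasurableSingletonClass S]
    (Q : S → Measure (ℕ → S))
    (hQprob : ∀ x, IsProbabilityMeasure (Q x))
    (hQcyl : ∀ (x : S) (n : ℕ) (s : ℕ → S),
      Q x {ω | ∀ i ≤ n, ω i = s i} =
        (if s 0 = x then 1 else 0) *
          ∏ i ∈ Finset.range n, ENNReal.ofReal (P (s i) (s (i + 1))))
    (Xinf : (ℕ → S) → C)
    (hXmeas : Measurable Xinf)
    (hXconv : ∀ x : S, ∀ᵐ ω ∂(Q x),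
      Xinf ω ∈ (Set.range ι)ᶜ ∧ Tendsto (fun n => ι (ω n)) atTop (𝓝 (Xinf ω)))
    (A : Set C) (hAsub : A ⊆ (Set.range ι)ᶜ)
    (hAopen : ∃ U : Set C, IsOpen U ∧ A = U ∩ (Set.range ι)ᶜ) :
    ∀ᵐ ω ∂μ, ∃ L : ℝ,
      Tendsto (fun n => (m ^ n)⁻¹ * ∑' x, (Q x (Xinf ⁻¹' A)).toReal * (B n ω x : ℝ))
        atTop (𝓝 L) ∧
      ∀ W : Measure C, IsFiniteMeasure W →
        IsSubseqWeakLimit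
          (fun n => brwMeasure ι fun x => ENNReal.ofReal ((m ^ n)⁻¹ * (B n ω x : ℝ))) W →
        W A = ENNReal.ofReal L := by
  have hp : ∀ x, ∑' y, ENNReal.ofReal (P x y) = 1 := fun x => by
    rw [← ENNReal.ofReal_tsum_of_nonneg (hP0 x) (hP1 x).summable, (hP1 x).tsum_eq,
      ENNReal.ofReal_one]
  have hQ := isMarkovLaw_of_cylinder hp hQprob hQcyl
  have hb := isNormalizedBranching_of_condExp hP0 (one_pos.trans hm) hadapt hfin hint hB0 hbranch
  have hX : ∀ x, ∀ᵐ w ∂Q x, Tendsto (fun n => ι (w n)) atTop (𝓝 (Xinf w)) :=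
    fun x => (hXconv x).mono fun _ h => h.2
  obtain ⟨U, hU, hAU⟩ := hAopen
  have hbd : IsClosed (Set.range ι)ᶜ := hι.isOpen_range.isClosed_compl
  have hAm : MeasurableSet A := hAU ▸ hU.measurableSet.inter hbd.measurableSet
  let _ : MetricSpace C := TopologicalSpace.metrizableSpaceMetric C
  obtain ⟨K, hKc, hKU, hKun, hKmono⟩ := hU.exists_iUnion_isClosed
  have hKA : ∀ j, K j ∩ (Set.range ι)ᶜ ⊆ A := fun j => by
    rw [hAU]
    exact Set.inter_subset_inter_left _ (hKU j)
  have hnull : ∀ x y, Q x (Xinf ⁻¹' {ι y}) = 0 := by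
    intro x y
    refine measure_mono_null (fun w hw => ?_) (hXconv x)
    intro h
    exact h.1 ⟨y, hw.symm⟩
  have hsplit : ∀ x, Q x (Xinf ⁻¹' A) + Q x (Xinf ⁻¹' Uᶜ) = 1 := by
    intro x
    rw [← prob_add_prob_compl (μ := Q x) (hXmeas hAm)]
    congr 1
    refine measure_congr ?_
    filter_upwards [hXconv x] with w hw
    apply propext
    change Xinf w ∈ Uᶜ ↔ Xinf w ∉ A
    rw [hAU]
    exact ⟨fun h h' => h h'.1, fun h h' => h ⟨h', hw.1⟩⟩
  filter_upwards [hb.ae_exists_tendsto_limit hQ hXmeas hX hAm,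
    hb.ae_closed_le hQ hXmeas hX hU.isClosed_compl,
    ae_all_iff.2 fun y => hb.ae_closed_le hQ hXmeas hX (isClosed_singleton (x := ι y)),
    ae_all_iff.2 fun j => hb.ae_closed_le hQ hXmeas hX ((hKc j).inter hbd)] with
    ω ⟨L, hLtop, hL⟩ ⟨L', hL'top, hL', hUle⟩ hpt hK
  have hsum : ∀ n, ENNReal.ofReal
      ((m ^ n)⁻¹ * ∑' x, (Q x (Xinf ⁻¹' A)).toReal * (B n ω x : ℝ)) =
        ∑' x, Q x (Xinf ⁻¹' A) * ENNReal.ofReal ((m ^ n)⁻¹ * (B n ω x : ℝ)) := by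
    intro n
    rw [← tsum_mul_left, ENNReal.ofReal_tsum_of_nonneg]
    · refine tsum_congr fun x => ?_
      rw [mul_left_comm, ENNReal.ofReal_mul ENNReal.toReal_nonneg,
        ENNReal.ofReal_toReal (measure_ne_top _ _)]
    · intro x
      positivity
    · refine summable_of_hasFiniteSupport ((hfin n ω).subset fun y hy => ?_)
      intro h0
      exact hy (by simp [h0])
  refine ⟨L.toReal, ?_, fun W hWfin hW => ?_⟩
  · refine ((ENNReal.tendsto_toReal hLtop).comp hL).congr fun n => ?_
    rw [Function.comp_apply, ← hsum, ENNReal.toReal_ofReal]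
    exact mul_nonneg (by positivity) (tsum_nonneg fun x => by positivity)
  rw [ENNReal.ofReal_toReal hLtop]
  have hνfin : ∀ n, IsFiniteMeasure
      (brwMeasure ι fun x => ENNReal.ofReal ((m ^ n)⁻¹ * (B n ω x : ℝ))) := fun n =>
    ⟨by rw [brwMeasure_univ]; exact (hb.tsum_ne_top n ω).lt_top⟩
  have hWuniv : W Set.univ = L + L' := by
    refine hW.measure_univ_eq hνfin ((hL.add hL').congr fun n => ?_)
    rw [brwMeasure_univ, ← ENNReal.tsum_add]
    exact tsum_congr fun x => by rw [← add_mul, hsplit, one_mul]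
  have hWS : W (Set.range ι) = 0 := by
    rw [← Set.iUnion_singleton_eq_range, measure_iUnion_null_iff]
    intro y
    obtain ⟨l, -, hl, hle⟩ := hpt y
    simp only [hnull, zero_mul, tsum_zero] at hl
    rw [tendsto_nhds_unique hl tendsto_const_nhds] at hle
    exact le_antisymm (hle W hWfin hW) zero_le
  apply le_antisymm
  · have hA : A = ⋃ j, K j ∩ (Set.range ι)ᶜ := by rw [← Set.iUnion_inter, hKun, hAU]
    have hmono : Monotone fun j => K j ∩ (Set.range ι)ᶜ :=
      fun i j hij => Set.inter_subset_inter_left _ (hKmono hij)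
    rw [hA, hmono.measure_iUnion]
    refine iSup_le fun j => ?_
    obtain ⟨l, -, hl, hle⟩ := hK j
    refine (hle W hWfin hW).trans (le_of_tendsto_of_tendsto' hl hL fun n => ?_)
    refine ENNReal.tsum_le_tsum fun x => ?_
    gcongr
    exact hKA j
  · have hcover : W Set.univ ≤ W A + W Uᶜ := by
      calc W Set.univ ≤ W (A ∪ Uᶜ ∪ Set.range ι) := measure_mono fun c _ => by
            by_cases hc : c ∈ Set.range ι
            · exact Or.inr hc
            · by_cases hcU : c ∈ U
              · exact Or.inl (Or.inl (hAU ▸ ⟨hcU, hc⟩))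
              · exact Or.inl (Or.inr hcU)
        _ ≤ W (A ∪ Uᶜ) + W (Set.range ι) := measure_union_le _ _
        _ ≤ W A + W Uᶜ := by rw [hWS, add_zero]; exact measure_union_le _ _
    rw [hWuniv] at hcover
    exact (ENNReal.add_le_add_iff_right hL'top).1
      (hcover.trans (add_le_add_right (hUle W hWfin hW) _))
end

section
/- Let φ : ∂ → ℝ be continuous and define its harmonic extension h : S → ℝ by h(x) := 𝐄_x[φ(X_∞)]. Then almost surely the limit lim_{n→∞} ⟨h, B̄_n⟩ exists, and every subsequential weak limit W of the sequence of random finite measures (B̄_n)_{n≥0} on C assigns zero mass to ι(S) and satisfies ∫_∂ φ dW = lim_{n→∞} ⟨h, B̄_n⟩. -/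
open MeasureTheory Filter Topology

namespace BranchingWalk

open scoped ENNReal

/-- Two finite measures on trajectories which agree on all initial segments are equal. -/
theorem measure_ext_of_initial_segment {S : Type*} [Countable S] [MeasurableSpace S]
    [MeasurableSingletonClass S] {ν₁ ν₂ : Measure (ℕ → S)} [IsFiniteMeasure ν₂]
    (h : ∀ (n : ℕ) (s : ℕ → S), ν₁ {ω | ∀ i ≤ n, ω i = s i} = ν₂ {ω | ∀ i ≤ n, ω i = s i}) :
    ν₁ = ν₂ := by
  rcases isEmpty_or_nonempty S with hS | hS
  · have : IsEmpty (ℕ → S) := ⟨fun f => hS.false (f 0)⟩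
    exact Subsingleton.elim _ _
  have key : ∀ n : ℕ, ν₁.map (Preorder.frestrictLe n) = ν₂.map (Preorder.frestrictLe n) := by
    intro n
    refine Measure.ext_of_singleton fun a => ?_
    have hpre : Preorder.frestrictLe (π := fun _ => S) n ⁻¹' {a} =
        {ω | ∀ i ≤ n, ω i =
          if hi : i ∈ Finset.Iic n then a ⟨i, hi⟩ else Classical.arbitrary S} := by
      ext ω
      simp only [Set.mem_preimage, Set.mem_singleton_iff, Set.mem_ofPred_eq]
      constructor
      · rintro rfl i hi
        simp [hi]
      · intro hω
        ext ⟨i, hi⟩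
        have := hω i (Finset.mem_Iic.1 hi)
        rwa [dif_pos hi] at this
    rw [Measure.map_apply (by fun_prop) (measurableSet_singleton a),
      Measure.map_apply (by fun_prop) (measurableSet_singleton a), hpre]
    exact h n _
  refine IsProjectiveLimit.unique (P := fun I => ν₂.map I.restrict) (fun I => ?_) (fun I => rfl)
  have hr : I.restrict (π := fun _ => S) =
      Finset.restrict₂ I.subset_Iic_sup_id ∘ Preorder.frestrictLe (I.sup id) := rfl
  change ν₁.map I.restrict = ν₂.map I.restrict
  rw [hr, ← Measure.map_map (by fun_prop) (by fun_prop),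
    ← Measure.map_map (by fun_prop) (by fun_prop), key]

/-- `Q x` is the law of the Markov chain with kernel `P` started at `x`. -/
structure IsChainLaw {S : Type*} [DecidableEq S] [MeasurableSpace S] (P : S → S → ℝ)
    (Q : S → Measure (ℕ → S)) : Prop where
  isProbabilityMeasure : ∀ x, IsProbabilityMeasure (Q x)
  cylinder_apply : ∀ (x : S) (n : ℕ) (s : ℕ → S),
    Q x {ω | ∀ i ≤ n, ω i = s i} =
      (if s 0 = x then 1 else 0) *
        ∏ i ∈ Finset.range n, ENNReal.ofReal (P (s i) (s (i + 1)))

/-- One-step action of the kernel `P` on `[0, ∞]`-valued functions. -/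
noncomputable def transition {S : Type*} (P : S → S → ℝ) (f : S → ℝ≥0∞) (x : S) : ℝ≥0∞ :=
  ∑' y, ENNReal.ofReal (P x y) * f y

/-- The chain started at `x` is at `x` at time zero. -/
theorem IsChainLaw.ae_start {S : Type*} [Countable S] [DecidableEq S] [MeasurableSpace S]
    [MeasurableSingletonClass S] {P : S → S → ℝ} {Q : S → Measure (ℕ → S)}
    (hQ : IsChainLaw P Q) (x : S) :
    ∀ᵐ ω ∂(Q x), ω 0 = x := by
  have := hQ.isProbabilityMeasure x
  have h0 := hQ.cylinder_apply x 0 (fun _ => x)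
  simp only [nonpos_iff_eq_zero, forall_eq, if_true, Finset.range_zero, Finset.prod_empty,
    mul_one] at h0
  exact (prob_compl_eq_zero_iff (measurableSet_eq_fun (measurable_pi_apply 0)
    measurable_const)).2 h0

/-- The Markov property at time one: the shifted chain started at `x` is the mixture of the
chains started at `y` with weights `P x y`. -/
theorem IsChainLaw.map_shift_eq_sum {S : Type*} [Countable S] [DecidableEq S] [MeasurableSpace S]
    [MeasurableSingletonClass S] {P : S → S → ℝ} {Q : S → Measure (ℕ → S)}
    (hQ : IsChainLaw P Q) (x : S) :
    Measure.sum (fun y => ENNReal.ofReal (P x y) • Q y) =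
      (Q x).map (fun ω n => ω (n + 1)) := by
  have hmeas : ∀ (n : ℕ) (s : ℕ → S), MeasurableSet {ω : ℕ → S | ∀ i ≤ n, ω i = s i} := by
    intro n s
    simp only [Set.ofPred_forall]
    exact MeasurableSet.iInter fun i => MeasurableSet.iInter fun _ =>
      measurableSet_eq_fun (measurable_pi_apply i) measurable_const
  have hshift : Measurable (fun (ω : ℕ → S) (n : ℕ) => ω (n + 1)) := by fun_prop
  have := hQ.isProbabilityMeasure x
  have : IsFiniteMeasure ((Q x).map (fun ω n => ω (n + 1))) := inferInstance
  refine measure_ext_of_initial_segment fun n s => ?_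
  rw [Measure.sum_apply _ (hmeas n s), Measure.map_apply hshift (hmeas n s)]
  have hset : Q x ((fun (ω : ℕ → S) (n : ℕ) => ω (n + 1)) ⁻¹' {ω | ∀ i ≤ n, ω i = s i}) =
      Q x {ω | ∀ i ≤ n + 1, ω i = (fun k => Nat.casesOn k x s : ℕ → S) i} := by
    refine measure_congr ?_
    filter_upwards [hQ.ae_start x] with ω hω
    refine propext ⟨fun h i hi => ?_, fun h i hi => h (i + 1) (by lia)⟩
    cases i with
    | zero => exact hω
    | succ i => exact h i (by lia)
  rw [hset, hQ.cylinder_apply, Finset.prod_range_succ']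
  simp only [Measure.smul_apply, hQ.cylinder_apply, smul_eq_mul]
  rw [tsum_eq_single (s 0)]
  · simp [mul_comm]
  · intro y hy
    simp [hy.symm]

theorem IsChainLaw.transition_lintegral {S : Type*} [Countable S] [DecidableEq S]
    [MeasurableSpace S] [MeasurableSingletonClass S] {P : S → S → ℝ}
    {Q : S → Measure (ℕ → S)} (hQ : IsChainLaw P Q)
    {f : (ℕ → S) → ℝ≥0∞} (hf : Measurable f) (x : S) :
    transition P (fun y => ∫⁻ ω, f ω ∂(Q y)) x = ∫⁻ ω, f (fun n => ω (n + 1)) ∂(Q x) := by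
  rw [← lintegral_map hf (by fun_prop), ← hQ.map_shift_eq_sum, lintegral_sum_measure]
  simp [transition, lintegral_smul_measure]

/-- `B` is a branching random walk with mean offspring `m` driven by the kernel `P`. -/
structure IsBranchingWalk {S Ω : Type*} {mΩ : MeasurableSpace Ω} (P : S → S → ℝ) (m : ℝ)
    (μ : Measure Ω) (F : Filtration ℕ mΩ) (B : ℕ → Ω → S → ℕ) : Prop where
  kernel_nonneg : ∀ x y, 0 ≤ P x y
  pos : 0 < m
  adapted : ∀ n x, Measurable[F n] (fun ω => B n ω x)
  finite_support : ∀ n ω, (Function.support (B n ω)).Finite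
  integrable : ∀ n x, Integrable (fun ω => (B n ω x : ℝ)) μ
  condExp_succ : ∀ n x,
    μ[fun ω => (B (n + 1) ω x : ℝ)|F n]
      =ᵐ[μ] fun ω => m * ∑' y, (B n ω y : ℝ) * P y x

/-- The rescaled pairing `⟨f, m⁻ⁿ b⟩` of a configuration at time `n`. -/
noncomputable def pairing {S : Type*} (m : ℝ) (n : ℕ) (f : S → ℝ≥0∞) (b : S → ℕ) : ℝ≥0∞ :=
  (ENNReal.ofReal m ^ n)⁻¹ * ∑' x, f x * (b x : ℝ≥0∞)

section Configuration

variable {S Ω : Type*} {mΩ : MeasurableSpace Ω} {μ : Measure Ω}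
  {F : Filtration ℕ mΩ} {B : ℕ → Ω → S → ℕ} {P : S → S → ℝ} {m : ℝ}

theorem IsBranchingWalk.setLIntegral_count_succ [IsFiniteMeasure μ]
    (hB : IsBranchingWalk P m μ F B) (n : ℕ) (x : S) {A : Set Ω} (hA : MeasurableSet[F n] A) :
    ∫⁻ ω in A, (B (n + 1) ω x : ℝ≥0∞) ∂μ =
      ∫⁻ ω in A, ENNReal.ofReal m * ∑' y, (B n ω y : ℝ≥0∞) * ENNReal.ofReal (P y x) ∂μ := by
  have hpos : ∀ ω, 0 ≤ m * ∑' y, (B n ω y : ℝ) * P y x := fun ω =>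
    mul_nonneg hB.pos.le
      (tsum_nonneg fun y => mul_nonneg (Nat.cast_nonneg _) (hB.kernel_nonneg y x))
  have hI : Integrable (fun ω => m * ∑' y, (B n ω y : ℝ) * P y x) μ :=
    integrable_condExp.congr (hB.condExp_succ n x)
  have hset : ∫ ω in A, (B (n + 1) ω x : ℝ) ∂μ =
      ∫ ω in A, m * ∑' y, (B n ω y : ℝ) * P y x ∂μ := by
    rw [← setIntegral_condExp (F.le n) (hB.integrable (n + 1) x) hA]
    exact setIntegral_congr_ae (F.le n A hA) ((hB.condExp_succ n x).mono fun ω h _ => h)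
  calc ∫⁻ ω in A, (B (n + 1) ω x : ℝ≥0∞) ∂μ
      = ∫⁻ ω in A, ENNReal.ofReal (B (n + 1) ω x : ℝ) ∂μ := by simp
    _ = ENNReal.ofReal (∫ ω in A, (B (n + 1) ω x : ℝ) ∂μ) :=
        (ofReal_integral_eq_lintegral_ofReal (hB.integrable (n + 1) x).integrableOn
          (ae_of_all _ fun ω => Nat.cast_nonneg _)).symm
    _ = ∫⁻ ω in A, ENNReal.ofReal (m * ∑' y, (B n ω y : ℝ) * P y x) ∂μ := by
        rw [hset, ofReal_integral_eq_lintegral_ofReal hI.integrableOn (ae_of_all _ hpos)]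
    _ = _ := by
        refine lintegral_congr fun ω => ?_
        rw [ENNReal.ofReal_mul hB.pos.le, ENNReal.ofReal_tsum_of_nonneg
          (fun y => mul_nonneg (Nat.cast_nonneg _) (hB.kernel_nonneg y x))
          (summable_of_hasFiniteSupport ((hB.finite_support n ω).subset fun y hy => by
            simp only [Function.mem_support] at hy ⊢
            rintro h0; simp [h0] at hy))]
        simp [ENNReal.ofReal_mul]

theorem measurable_pairing [Countable S] {m0 : MeasurableSpace Ω} {b : Ω → S → ℕ}
    (hb : ∀ x, Measurable fun ω => b ω x) (m : ℝ) (n : ℕ) (f : S → ℝ≥0∞) :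
    Measurable fun ω => pairing m n f (b ω) := by
  unfold pairing
  refine Measurable.const_mul (Measurable.tsum fun x => ?_) _
  exact Measurable.const_mul ((measurable_of_countable (fun k : ℕ => (k : ℝ≥0∞))).comp (hb x)) _

theorem IsBranchingWalk.setLIntegral_pairing_succ [Countable S] [IsFiniteMeasure μ]
    (hB : IsBranchingWalk P m μ F B) (f : S → ℝ≥0∞) (n : ℕ) {A : Set Ω}
    (hA : MeasurableSet[F n] A) :
    ∫⁻ ω in A, pairing m (n + 1) f (B (n + 1) ω) ∂μ =
      ∫⁻ ω in A, pairing m n (transition P f) (B n ω) ∂μ := by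
  have hmB : ∀ n x, Measurable fun ω => (B n ω x : ℝ≥0∞) := fun n x =>
    (measurable_of_countable (fun k : ℕ => (k : ℝ≥0∞))).comp
      ((hB.adapted n x).mono (F.le n) le_rfl)
  have hm0 : ENNReal.ofReal m ≠ 0 := by simpa using hB.pos
  have hmP : ∀ x, Measurable fun ω => ENNReal.ofReal m *
      ∑' y, (B n ω y : ℝ≥0∞) * ENNReal.ofReal (P y x) := fun x =>
    (Measurable.tsum fun y => (hmB n y).mul_const _).const_mul _
  unfold pairing
  rw [lintegral_const_mul _ (Measurable.tsum fun x => (hmB (n + 1) x).const_mul _),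
    lintegral_tsum (fun x => ((hmB (n + 1) x).const_mul _).aemeasurable)]
  have h1 : ∀ x, ∫⁻ ω in A, f x * (B (n + 1) ω x : ℝ≥0∞) ∂μ =
      ∫⁻ ω in A, f x * (ENNReal.ofReal m *
        ∑' y, (B n ω y : ℝ≥0∞) * ENNReal.ofReal (P y x)) ∂μ := by
    intro x
    rw [lintegral_const_mul _ (hmB _ x), lintegral_const_mul _ (hmP x),
      hB.setLIntegral_count_succ n x hA]
  simp_rw [h1]
  rw [← lintegral_tsum (fun x => ((hmP x).const_mul _).aemeasurable),
    ← lintegral_const_mul _ (Measurable.tsum fun x => (hmP x).const_mul _)]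
  refine lintegral_congr fun ω => ?_
  simp only [transition]
  simp_rw [← ENNReal.tsum_mul_left, ← ENNReal.tsum_mul_right, ← ENNReal.tsum_mul_left]
  rw [ENNReal.tsum_comm]
  refine tsum_congr fun y => tsum_congr fun x => ?_
  have : (ENNReal.ofReal m ^ (n + 1))⁻¹ * ENNReal.ofReal m = (ENNReal.ofReal m ^ n)⁻¹ := by
    rw [pow_succ, ENNReal.mul_inv (Or.inr ENNReal.ofReal_ne_top) (Or.inr hm0), mul_assoc,
      ENNReal.inv_mul_cancel hm0 ENNReal.ofReal_ne_top, mul_one]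
  rw [← this]
  ring

theorem pairing_mono (m : ℝ) (n : ℕ) {f g : S → ℝ≥0∞} (hfg : ∀ x, f x ≤ g x) (b : S → ℕ) :
    pairing m n f b ≤ pairing m n g b := by
  unfold pairing
  gcongr with x
  exact hfg x

theorem pairing_ne_top (hm : 0 < m) (n : ℕ) {f : S → ℝ≥0∞} (hf : ∀ x, f x ≠ ∞) {b : S → ℕ}
    (hb : (Function.support b).Finite) : pairing m n f b ≠ ∞ := by
  have hm0 : ENNReal.ofReal m ≠ 0 := by simpa using hm
  unfold pairing
  refine ENNReal.mul_ne_top (ENNReal.inv_ne_top.2 (pow_ne_zero n hm0)) ?_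
  rw [tsum_eq_sum (s := hb.toFinset) (fun x hx => by simp_all)]
  exact ENNReal.sum_ne_top.2 fun x _ => ENNReal.mul_ne_top (hf x) (ENNReal.natCast_ne_top _)

theorem pairing_single [DecidableEq S] (m : ℝ) (f : S → ℝ≥0∞) {o : S} {b : S → ℕ}
    (hb : ∀ x, b x = if x = o then 1 else 0) : pairing m 0 f b = f o := by
  simp only [pairing, pow_zero, inv_one, one_mul, hb]
  rw [tsum_eq_single o (fun x hx => by simp [hx])]
  simp

theorem toReal_pairing (hm : 0 < m) (n : ℕ) {f : S → ℝ≥0∞} (hf : ∀ x, f x ≠ ∞) (b : S → ℕ) :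
    (pairing m n f b).toReal = (m ^ n)⁻¹ * ∑' x, (f x).toReal * (b x : ℝ) := by
  unfold pairing
  rw [ENNReal.toReal_mul, ENNReal.tsum_toReal_eq
    (fun x => ENNReal.mul_ne_top (hf x) (ENNReal.natCast_ne_top _))]
  simp [ENNReal.toReal_mul, hm.le]

/-- The pairing with a finite superharmonic function converges almost surely. -/
theorem IsBranchingWalk.ae_tendsto_pairing [Countable S] [IsFiniteMeasure μ]
    (hB : IsBranchingWalk P m μ F B) {f : S → ℝ≥0∞} (hf : ∀ x, f x ≠ ∞)
    (hsup : ∀ x, transition P f x ≤ f x) (h0 : ∫⁻ ω, pairing m 0 f (B 0 ω) ∂μ ≠ ∞) :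
    ∀ᵐ ω ∂μ, ∃ c : ℝ,
      Tendsto (fun n => (pairing m n f (B n ω)).toReal) atTop (𝓝 c) := by
  have hmF : ∀ n, Measurable[F n] fun ω => pairing m n f (B n ω) := fun n =>
    measurable_pairing (hB.adapted n) m n f
  have hmeas : ∀ n, Measurable fun ω => pairing m n f (B n ω) := fun n =>
    (hmF n).mono (F.le n) le_rfl
  have htop : ∀ n ω, pairing m n f (B n ω) ≠ ∞ := fun n ω =>
    pairing_ne_top hB.pos n hf (hB.finite_support n ω)
  have hstep : ∀ n (A : Set Ω), MeasurableSet[F n] A →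
      ∫⁻ ω in A, pairing m (n + 1) f (B (n + 1) ω) ∂μ ≤
        ∫⁻ ω in A, pairing m n f (B n ω) ∂μ := by
    intro n A hA
    rw [hB.setLIntegral_pairing_succ f n hA]
    exact lintegral_mono fun ω => pairing_mono m n hsup _
  have hbdd : ∀ n, ∫⁻ ω, pairing m n f (B n ω) ∂μ ≤ ∫⁻ ω, pairing m 0 f (B 0 ω) ∂μ := by
    intro n
    induction n with
    | zero => exact le_rfl
    | succ n ih =>
      refine le_trans ?_ ih
      simpa using hstep n Set.univ MeasurableSet.univ
  have hne : ∀ n, ∫⁻ ω, pairing m n f (B n ω) ∂μ ≠ ∞ := fun n => ne_top_of_le_ne_top h0 (hbdd n)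
  have hsuper : Supermartingale (fun n ω => (pairing m n f (B n ω)).toReal) F μ := by
    refine supermartingale_of_setIntegral_succ_le
      (fun n => (hmF n).ennreal_toReal.stronglyMeasurable)
      (fun n => integrable_toReal_of_lintegral_ne_top (hmeas n).aemeasurable (hne n))
      fun n A hA => ?_
    rw [integral_toReal (hmeas _).aemeasurable (ae_of_all _ fun ω => (htop _ ω).lt_top),
      integral_toReal (hmeas _).aemeasurable (ae_of_all _ fun ω => (htop _ ω).lt_top)]
    exact ENNReal.toReal_mono (ne_top_of_le_ne_top (hne n) (setLIntegral_le_lintegral _ _))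
      (hstep n A hA)
  have hconv := hsuper.neg.exists_ae_tendsto_of_bdd
    (R := (∫⁻ ω, pairing m 0 f (B 0 ω) ∂μ).toNNReal) fun n => by
      rw [eLpNorm_one_eq_lintegral_enorm, ENNReal.coe_toNNReal h0]
      refine le_trans (le_of_eq (lintegral_congr fun ω => ?_)) (hbdd n)
      simp only [Pi.neg_apply, enorm_neg]
      rw [Real.enorm_of_nonneg ENNReal.toReal_nonneg, ENNReal.ofReal_toReal (htop n ω)]
  filter_upwards [hconv] with ω hω
  obtain ⟨c, hc⟩ := hω
  exact ⟨-c, by simpa using hc.neg⟩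

/-- If `G k` is the `k`-th transition iterate of the finite superharmonic function `G 0` and
tends to zero at the starting point, then the pairing with `G 0` vanishes asymptotically. -/
theorem IsBranchingWalk.ae_tendsto_pairing_zero [Countable S] [DecidableEq S]
    [IsProbabilityMeasure μ] (hB : IsBranchingWalk P m μ F B) {o : S}
    (hB0 : ∀ ω x, B 0 ω x = if x = o then 1 else 0) {G : ℕ → S → ℝ≥0∞}
    (hG : ∀ x, G 0 x ≠ ∞) (hsucc : ∀ k x, transition P (G k) x = G (k + 1) x)
    (hsup : ∀ x, G 1 x ≤ G 0 x) (hlim : Tendsto (fun k => G k o) atTop (𝓝 0)) :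
    ∀ᵐ ω ∂μ, Tendsto (fun n => (pairing m n (G 0) (B n ω)).toReal) atTop (𝓝 0) := by
  have hstart : ∀ f : S → ℝ≥0∞, ∀ ω, pairing m 0 f (B 0 ω) = f o := fun f ω =>
    pairing_single m f (hB0 ω)
  have hmean : ∀ n k, ∫⁻ ω, pairing m n (G k) (B n ω) ∂μ = G (n + k) o := by
    intro n
    induction n with
    | zero => intro k; simp [hstart]
    | succ n ih =>
      intro k
      have := hB.setLIntegral_pairing_succ (G k) n MeasurableSet.univ
      simp only [Measure.restrict_univ] at this
      rw [this, show transition P (G k) = G (k + 1) from funext (hsucc k), ih]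
      congr 1
      lia
  have hmeas : ∀ n, Measurable fun ω => pairing m n (G 0) (B n ω) := fun n =>
    (measurable_pairing (hB.adapted n) m n (G 0)).mono (F.le n) le_rfl
  have hliminf : ∫⁻ ω, liminf (fun n => pairing m n (G 0) (B n ω)) atTop ∂μ = 0 := by
    refine le_antisymm ((lintegral_liminf_le hmeas).trans ?_) zero_le
    simp only [hmean, add_zero]
    exact hlim.liminf_eq.le
  have hzero := (lintegral_eq_zero_iff (Measurable.liminf hmeas)).1 hliminf
  filter_upwards [hzero, hB.ae_tendsto_pairing hG (fun x => (hsucc 0 x).trans_le (hsup x))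
    (by simpa [hstart] using hG o)] with ω h1 h2
  obtain ⟨c, hc⟩ := h2
  have hc' : Tendsto (fun n => pairing m n (G 0) (B n ω)) atTop (𝓝 (ENNReal.ofReal c)) := by
    refine (ENNReal.tendsto_ofReal hc).congr fun n => ENNReal.ofReal_toReal ?_
    exact pairing_ne_top hB.pos n hG (hB.finite_support n ω)
  have h3 : ENNReal.ofReal c = 0 := hc'.liminf_eq.symm.trans h1
  have h4 : c = 0 := le_antisymm (ENNReal.ofReal_eq_zero.1 h3)
    (ge_of_tendsto' hc fun n => ENNReal.toReal_nonneg)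
  rwa [h4] at hc

end Configuration

/-- The oscillation of `g` along the trajectory `ω` from time `k` on. -/
noncomputable def tailOscillation {S : Type*} (g : S → ℝ) (k : ℕ) (ω : ℕ → S) : ℝ≥0∞ :=
  ⨆ i, ⨆ j, edist (g (ω (k + i))) (g (ω (k + j)))

section Oscillation

variable {S : Type*} {g : S → ℝ}

theorem measurable_tailOscillation [Countable S] [MeasurableSpace S] [MeasurableSingletonClass S]
    (g : S → ℝ) (k : ℕ) : Measurable (tailOscillation g k) := by
  have hg : Measurable g := measurable_of_countable g
  unfold tailOscillation
  exact Measurable.iSup fun i => Measurable.iSup fun j =>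
    (hg.comp (measurable_pi_apply _)).edist (hg.comp (measurable_pi_apply _))

theorem tailOscillation_shift (g : S → ℝ) (k : ℕ) (ω : ℕ → S) :
    tailOscillation g k (fun n => ω (n + 1)) = tailOscillation g (k + 1) ω := by
  simp only [tailOscillation, Nat.add_right_comm]

theorem tailOscillation_succ_le (g : S → ℝ) (k : ℕ) (ω : ℕ → S) :
    tailOscillation g (k + 1) ω ≤ tailOscillation g k ω := by
  refine iSup_le fun i => iSup_le fun j => ?_
  rw [add_assoc, add_assoc]
  exact le_iSup_of_le (1 + i) (le_iSup_of_le (1 + j) le_rfl)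

theorem tailOscillation_le {K : ℝ} (hg : ∀ x, |g x| ≤ K) (k : ℕ) (ω : ℕ → S) :
    tailOscillation g k ω ≤ ENNReal.ofReal (K + K) := by
  refine iSup_le fun i => iSup_le fun j => ?_
  rw [edist_dist]
  refine ENNReal.ofReal_le_ofReal ?_
  rw [Real.dist_eq]
  exact (abs_sub _ _).trans (add_le_add (hg _) (hg _))

theorem tendsto_tailOscillation {ω : ℕ → S} {z : ℝ}
    (h : Tendsto (fun n => g (ω n)) atTop (𝓝 z)) :
    Tendsto (fun k => tailOscillation g k ω) atTop (𝓝 0) := by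
  refine ENNReal.tendsto_nhds_zero.2 fun ε hε => ?_
  obtain ⟨N, hN⟩ := EMetric.cauchySeq_iff.1 h.cauchySeq ε hε
  filter_upwards [eventually_ge_atTop N] with k hk
  exact iSup_le fun i => iSup_le fun j => (hN _ (by lia) _ (by lia)).le

theorem edist_start_le_tailOscillation {ω : ℕ → S} {z : ℝ}
    (h : Tendsto (fun n => g (ω n)) atTop (𝓝 z)) :
    edist (g (ω 0)) z ≤ tailOscillation g 0 ω := by
  refine le_of_tendsto' (tendsto_const_nhds.edist h) fun n => ?_
  refine le_iSup_of_le 0 (le_iSup_of_le n ?_)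
  simp

end Oscillation

/-- If a bounded function `g` converges to `Z` along the trajectories of the driving chain, then
the pairings of the branching random walk with `g` and with the harmonic function `𝐄ₓ[Z]`
converge almost surely to the same limit. -/
theorem IsBranchingWalk.ae_tendsto_harmonic_extension {S Ω : Type*} [Countable S] [DecidableEq S]
    [MeasurableSpace S] [MeasurableSingletonClass S] {mΩ : MeasurableSpace Ω} {μ : Measure Ω}
    [IsProbabilityMeasure μ] {F : Filtration ℕ mΩ} {B : ℕ → Ω → S → ℕ} {P : S → S → ℝ} {m : ℝ}
    (hB : IsBranchingWalk P m μ F B) (hP1 : ∀ x, HasSum (fun y => P x y) 1) {o : S}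
    (hB0 : ∀ ω x, B 0 ω x = if x = o then 1 else 0) {Q : S → Measure (ℕ → S)}
    (hQ : IsChainLaw P Q) {g : S → ℝ} {K : ℝ} (hg : ∀ x, |g x| ≤ K) {Z : (ℕ → S) → ℝ}
    (hZ : ∀ x, ∀ᵐ ω ∂(Q x), Tendsto (fun n => g (ω n)) atTop (𝓝 (Z ω))) :
    ∀ᵐ ω ∂μ, ∃ L : ℝ,
      Tendsto (fun n => (m ^ n)⁻¹ * ∑' x, (∫ ω', Z ω' ∂(Q x)) * (B n ω x : ℝ)) atTop (𝓝 L) ∧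
      Tendsto (fun n => (m ^ n)⁻¹ * ∑' x, g x * (B n ω x : ℝ)) atTop (𝓝 L) := by
  have hprob := hQ.isProbabilityMeasure
  have hgm : Measurable g := measurable_of_countable g
  have hZm : ∀ x, AEStronglyMeasurable Z (Q x) := fun x =>
    aestronglyMeasurable_of_tendsto_ae atTop
      (fun n => (hgm.comp (measurable_pi_apply n)).aestronglyMeasurable) (hZ x)
  have hZK : ∀ x, ∀ᵐ ω ∂(Q x), ‖Z ω‖ ≤ K := fun x => (hZ x).mono fun ω hω =>
    le_of_tendsto' hω.norm fun n => hg _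
  have hZI : ∀ x, Integrable Z (Q x) := fun x => Integrable.of_bound (hZm x) K (hZK x)
  set h : S → ℝ := fun x => ∫ ω', Z ω' ∂(Q x) with hh
  -- the oscillation potential
  let G : ℕ → S → ℝ≥0∞ := fun k x => ∫⁻ ω, tailOscillation g k ω ∂(Q x)
  have hGtop : ∀ x, G 0 x ≠ ∞ := fun x => by
    have hle : G 0 x ≤ ∫⁻ _, ENNReal.ofReal (K + K) ∂(Q x) :=
      lintegral_mono fun ω => tailOscillation_le hg 0 ω
    rw [lintegral_const, measure_univ, mul_one] at hle
    exact ne_top_of_le_ne_top ENNReal.ofReal_ne_top hle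
  have hGsucc : ∀ k x, transition P (G k) x = G (k + 1) x := fun k x => by
    rw [hQ.transition_lintegral (measurable_tailOscillation g k)]
    simp only [tailOscillation_shift, G]
  have hGlim : Tendsto (fun k => G k o) atTop (𝓝 0) := by
    have := tendsto_lintegral_of_dominated_convergence (μ := Q o)
      (F := fun k => tailOscillation g k) (f := fun _ => 0) (fun _ => ENNReal.ofReal (K + K))
      (fun k => measurable_tailOscillation g k) (fun k => ae_of_all _ (tailOscillation_le hg k))
      (by simp) ((hZ o).mono fun ω hω => tendsto_tailOscillation hω)
    simpa using this
  have hgap : ∀ x, |g x - h x| ≤ (G 0 x).toReal := fun x => by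
    have h1 : g x - h x = ∫ ω, (g x - Z ω) ∂(Q x) := by
      rw [integral_sub (integrable_const _) (hZI x)]
      simp [hh]
    have h2 : ‖g x - h x‖ₑ ≤ G 0 x := by
      rw [h1]
      refine (enorm_integral_le_lintegral_enorm _).trans (lintegral_mono_ae ?_)
      filter_upwards [hZ x, hQ.ae_start x] with ω hω h0
      have := edist_start_le_tailOscillation hω
      rwa [h0, edist_eq_enorm_sub] at this
    rw [← Real.norm_eq_abs, ← toReal_enorm]
    exact ENNReal.toReal_mono (hGtop x) h2
  -- the shifted harmonic function
  let H : S → ℝ≥0∞ := fun x =>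
    ∫⁻ ω, limsup (fun n => ENNReal.ofReal (g (ω n) + K)) atTop ∂(Q x)
  have hK : ∀ x, 0 ≤ h x + K := fun x => by
    have := norm_integral_le_of_norm_le_const (hZK x)
    rw [probReal_univ, mul_one] at this
    linarith [neg_le_of_abs_le this]
  have hHeq : ∀ x, H x = ENNReal.ofReal (h x + K) := fun x => by
    have h1 : h x + K = ∫ ω, (Z ω + K) ∂(Q x) := by
      rw [integral_add (hZI x) (integrable_const _)]
      simp [hh]
    have hI : Integrable (fun ω => Z ω + K) (Q x) := (hZI x).add (integrable_const K)
    rw [h1, ofReal_integral_eq_lintegral_ofReal hI]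
    · refine lintegral_congr_ae ?_
      filter_upwards [hZ x] with ω hω
      exact (ENNReal.tendsto_ofReal (hω.add_const K)).limsup_eq
    · filter_upwards [hZK x] with ω hω
      have := neg_le_of_abs_le hω
      simp only [Pi.zero_apply]
      linarith
  have hHtop : ∀ x, H x ≠ ∞ := fun x => by rw [hHeq]; exact ENNReal.ofReal_ne_top
  have hHharm : ∀ x, transition P H x = H x := fun x => by
    rw [hQ.transition_lintegral (Measurable.limsup fun n => by fun_prop)]
    simp only [H]
    refine lintegral_congr fun ω => ?_
    exact limsup_nat_add (fun n => ENNReal.ofReal (g (ω n) + K)) 1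
  have hone : ∀ x, transition P 1 x = 1 := fun x => by
    simp only [transition, Pi.one_apply, mul_one]
    rw [← ENNReal.ofReal_tsum_of_nonneg (hB.kernel_nonneg x) (hP1 x).summable, (hP1 x).tsum_eq,
      ENNReal.ofReal_one]
  have hstart : ∀ f : S → ℝ≥0∞, (∀ x, f x ≠ ∞) → ∫⁻ ω, pairing m 0 f (B 0 ω) ∂μ ≠ ∞ := by
    intro f hf
    simpa [pairing_single m f (hB0 _)] using hf o
  filter_upwards [hB.ae_tendsto_pairing_zero hB0 hGtop hGsucc
      (fun x => lintegral_mono fun ω => tailOscillation_succ_le g 0 ω) hGlim,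
    hB.ae_tendsto_pairing hHtop (fun x => (hHharm x).le) (hstart H hHtop),
    hB.ae_tendsto_pairing (f := 1) (fun x => by simp) (fun x => (hone x).le)
      (hstart 1 fun x => by simp)] with ω hω0 ⟨c, hc⟩ ⟨d, hd⟩
  have hsum : ∀ (u : S → ℝ) (n : ℕ), Summable fun x => u x * (B n ω x : ℝ) := fun u n =>
    summable_of_hasFiniteSupport ((hB.finite_support n ω).subset fun x hx => by
      simp only [Function.mem_support] at hx ⊢
      rintro h0
      simp [h0] at hx)
  simp only [toReal_pairing hB.pos _ hGtop] at hω0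
  simp only [toReal_pairing hB.pos _ hHtop, hHeq, ENNReal.toReal_ofReal (hK _)] at hc
  simp only [toReal_pairing hB.pos _ (fun x => show (1 : S → ℝ≥0∞) x ≠ ∞ by simp)] at hd
  have hlim : Tendsto (fun n => (m ^ n)⁻¹ * ∑' x, h x * (B n ω x : ℝ)) atTop (𝓝 (c - K * d)) := by
    refine (hc.sub (hd.const_mul K)).congr fun n => ?_
    simp only [add_mul, Pi.one_apply, ENNReal.toReal_one, one_mul]
    rw [(hsum h n).tsum_add (hsum (fun _ => K) n), tsum_mul_left]
    ring
  refine ⟨c - K * d, hlim, ?_⟩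
  have hdiff : Tendsto (fun n => (m ^ n)⁻¹ * ∑' x, g x * (B n ω x : ℝ) -
      (m ^ n)⁻¹ * ∑' x, h x * (B n ω x : ℝ)) atTop (𝓝 0) := by
    refine squeeze_zero_norm (fun n => ?_) hω0
    have hm : 0 ≤ (m ^ n)⁻¹ := inv_nonneg.2 (pow_nonneg hB.pos.le n)
    rw [← mul_sub, ← (hsum g n).tsum_sub (hsum h n), norm_mul, Real.norm_of_nonneg hm]
    refine mul_le_mul_of_nonneg_left ?_ hm
    simp only [← sub_mul]
    refine (norm_tsum_le_tsum_norm (hsum (fun x => g x - h x) n).norm).trans ?_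
    refine (hsum (fun x => g x - h x) n).norm.tsum_le_tsum (fun x => ?_)
      (hsum (fun x => (G 0 x).toReal) n)
    rw [norm_mul, Real.norm_natCast]
    exact mul_le_mul_of_nonneg_right (hgap x) (Nat.cast_nonneg _)
  simpa using hdiff.add hlim

/-- Integration against a finitely supported configuration measure. -/
theorem integral_brwMeasure {S C : Type*} [MeasurableSpace C] [MeasurableSingletonClass C]
    (ι : S → C) {w : S → ℝ} (hw : ∀ x, 0 ≤ w x) (hfin : (Function.support w).Finite) (f : C → ℝ) :
    ∫ c, f c ∂(brwMeasure ι fun x => ENNReal.ofReal (w x)) = ∑' x, f (ι x) * w x := by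
  have hmeas : brwMeasure ι (fun x => ENNReal.ofReal (w x)) =
      ∑ x ∈ hfin.toFinset, ENNReal.ofReal (w x) • Measure.dirac (ι x) := by
    ext A hA
    rw [brwMeasure, Measure.sum_apply _ hA, Measure.finsetSum_apply]
    exact tsum_eq_sum fun x hx => by simp_all
  rw [hmeas, integral_finsetSum_measure]
  · rw [tsum_eq_sum (s := hfin.toFinset) (fun x hx => by simp_all)]
    refine Finset.sum_congr rfl fun x _ => ?_
    rw [integral_smul_measure, integral_dirac, ENNReal.toReal_ofReal (hw x), smul_eq_mul, mul_comm]
  · intro x _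
    exact (integrable_dirac (by simp)).smul_measure ENNReal.ofReal_ne_top

end BranchingWalk

/-- Let `φ : ∂ → ℝ` be continuous, with harmonic extension
`h(x) := 𝐄ₓ[φ(X_∞)]`. Almost surely the limit `limₙ ⟨h, B̄ₙ⟩` exists, and every
subsequential weak limit `W` of the random measures `B̄ₙ` on `C` assigns zero mass to
`ι(S)` and satisfies `∫_∂ φ dW = limₙ ⟨h, B̄ₙ⟩`. -/
theorem brw_continuous_function_integral
    {S : Type*} [Countable S] [DecidableEq S]
    (P : S → S → ℝ)
    (hP0 : ∀ x y, 0 ≤ P x y)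
    (hP1 : ∀ x, HasSum (fun y => P x y) 1)
    (m : ℝ) (hm : 1 < m) (o : S)
    {Ω : Type*} {mΩ : MeasurableSpace Ω}
    (μ : Measure Ω) [IsProbabilityMeasure μ]
    (F : Filtration ℕ mΩ)
    (B : ℕ → Ω → S → ℕ)
    (hadapt : ∀ n x, Measurable[F n] (fun ω => B n ω x))
    (hfin : ∀ n ω, (Function.support (B n ω)).Finite)
    (hint : ∀ n x, Integrable (fun ω => (B n ω x : ℝ)) μ)
    (hB0 : ∀ ω x, B 0 ω x = if x = o then 1 else 0)
    (hbranch : ∀ n x,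
      μ[fun ω => (B (n + 1) ω x : ℝ)|F n]
        =ᵐ[μ] fun ω => m * ∑' y, (B n ω y : ℝ) * P y x)
    {C : Type*} [TopologicalSpace C] [CompactSpace C]
    [TopologicalSpace.MetrizableSpace C] [MeasurableSpace C] [BorelSpace C]
    [TopologicalSpace S] [DiscreteTopology S]
    (ι : S → C) (hι : IsOpenEmbedding ι)
    [MeasurableSpace S] [MeasurableSingletonClass S]
    (Q : S → Measure (ℕ → S))
    (hQprob : ∀ x, IsProbabilityMeasure (Q x))
    (hQcyl : ∀ (x : S) (n : ℕ) (s : ℕ → S),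
      Q x {ω | ∀ i ≤ n, ω i = s i} =
        (if s 0 = x then 1 else 0) *
          ∏ i ∈ Finset.range n, ENNReal.ofReal (P (s i) (s (i + 1))))
    (Xinf : (ℕ → S) → C)
    (hXmeas : Measurable Xinf)
    (hXconv : ∀ x : S, ∀ᵐ ω ∂(Q x),
      Xinf ω ∈ (Set.range ι)ᶜ ∧ Tendsto (fun n => ι (ω n)) atTop (𝓝 (Xinf ω)))
    (φ : C → ℝ) (hφ : ContinuousOn φ (Set.range ι)ᶜ) :
    ∀ᵐ ω ∂μ, ∃ L : ℝ,
      Tendsto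
        (fun n => (m ^ n)⁻¹ * ∑' x, (∫ ω', φ (Xinf ω') ∂(Q x)) * (B n ω x : ℝ))
        atTop (𝓝 L) ∧
      ∀ W : Measure C, IsFiniteMeasure W →
        IsSubseqWeakLimit
          (fun n => brwMeasure ι fun x => ENNReal.ofReal ((m ^ n)⁻¹ * (B n ω x : ℝ))) W →
        W (Set.range ι) = 0 ∧ (∫ c in (Set.range ι)ᶜ, φ c ∂W) = L := by
  have hB : BranchingWalk.IsBranchingWalk P m μ F B :=
    ⟨hP0, by linarith, hadapt, hfin, hint, hbranch⟩
  have hQ : BranchingWalk.IsChainLaw P Q := ⟨hQprob, hQcyl⟩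
  have hclosed : IsClosed (Set.range ι)ᶜ := hι.isOpen_range.isClosed_compl
  obtain ⟨Φ, hΦ⟩ := ContinuousMap.exists_restrict_eq hclosed
    ⟨(Set.range ι)ᶜ.domRestrict φ, hφ.domRestrict⟩
  have hΦeq : ∀ c ∈ (Set.range ι)ᶜ, Φ c = φ c := fun c hc =>
    DFunLike.congr_fun hΦ (⟨c, hc⟩ : ((Set.range ι)ᶜ : Set C))
  have hext : ∀ Ψ : C(C, ℝ), ∀ᵐ ω ∂μ, ∃ L : ℝ,
      Tendsto (fun n => (m ^ n)⁻¹ * ∑' x, (∫ ω', Ψ (Xinf ω') ∂(Q x)) * (B n ω x : ℝ))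
        atTop (𝓝 L) ∧
      Tendsto (fun n => (m ^ n)⁻¹ * ∑' x, Ψ (ι x) * (B n ω x : ℝ)) atTop (𝓝 L) := fun Ψ =>
    hB.ae_tendsto_harmonic_extension hP1 hB0 hQ (g := fun x => Ψ (ι x)) (K := ‖Ψ‖)
      (fun x => Ψ.norm_coe_le_norm (ι x))
      (fun x => (hXconv x).mono fun ω hω => (Ψ.continuous.tendsto _).comp hω.2)
  have hclopen : ∀ x, IsClopen ({ι x} : Set C) := fun x =>
    ⟨isClosed_singleton, by simpa using hι.isOpenMap {x} (isOpen_discrete _)⟩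
  let χ : S → C(C, ℝ) := fun x =>
    ⟨({ι x} : Set C).indicator 1,
      continuous_one.indicator fun a ha => by simp [(hclopen x).frontier_eq] at ha⟩
  have hlimW : ∀ (Ψ : C(C, ℝ)) (ω : Ω) (L : ℝ) (W : Measure C),
      Tendsto (fun n => (m ^ n)⁻¹ * ∑' x, Ψ (ι x) * (B n ω x : ℝ)) atTop (𝓝 L) →
      IsSubseqWeakLimit
        (fun n => brwMeasure ι fun x => ENNReal.ofReal ((m ^ n)⁻¹ * (B n ω x : ℝ))) W →
      ∫ c, Ψ c ∂W = L := by
    rintro Ψ ω L W hL ⟨θ, hθ, hW⟩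
    refine tendsto_nhds_unique (hW (BoundedContinuousFunction.mkOfCompact Ψ))
      ((hL.comp hθ.tendsto_atTop).congr fun k => ?_)
    simp only [Function.comp_apply, BoundedContinuousFunction.mkOfCompact_apply]
    rw [BranchingWalk.integral_brwMeasure ι
      (fun x => mul_nonneg (inv_nonneg.2 (pow_nonneg hB.pos.le _)) (Nat.cast_nonneg _))
      ((hfin (θ k) ω).subset fun x hx => by
        simp only [Function.mem_support] at hx ⊢
        rintro h0
        simp [h0] at hx), ← tsum_mul_left]
    exact tsum_congr fun x => by ring
  filter_upwards [hext Φ, ae_all_iff.2 fun x => hext (χ x)] with ω ⟨L, hL, hL'⟩ hχ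
  refine ⟨L, hL.congr fun n => ?_, fun W hWfin hW => ?_⟩
  · congr 1
    refine tsum_congr fun x => ?_
    congr 1
    exact integral_congr_ae ((hXconv x).mono fun ω' hω' => hΦeq _ hω'.1)
  have hnull : W (Set.range ι) = 0 := by
    rw [← Set.iUnion_singleton_eq_range, measure_iUnion_null_iff]
    intro x
    obtain ⟨l, hl, hl'⟩ := hχ x
    have hzero : ∀ y, ∫ ω', χ x (Xinf ω') ∂(Q y) = 0 := fun y =>
      integral_eq_zero_of_ae ((hXconv y).mono fun ω' hω' =>
        Set.indicator_of_notMem (fun h => hω'.1 ⟨x, h.symm⟩) _)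
    have hl0 : l = 0 := tendsto_nhds_unique hl (by simp [hzero])
    have hI : ∫ c, χ x c ∂W = 0 := by rw [hlimW (χ x) ω l W hl' hW, hl0]
    have hI' : ∫ c, χ x c ∂W = W.real {ι x} := integral_indicator_one (measurableSet_singleton _)
    exact (measureReal_eq_zero_iff).1 (hI'.symm.trans hI)
  refine ⟨hnull, ?_⟩
  rw [← hlimW Φ ω L W hL' hW, ← setIntegral_congr_fun hclosed.measurableSet fun c hc => hΦeq c hc,
    setIntegral_eq_integral_of_ae_compl_eq_zero]
  have hae : ∀ᵐ c ∂W, c ∉ Set.range ι := measure_eq_zero_iff_ae_notMem.1 hnull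
  filter_upwards [hae] with c hc hc'
  exact absurd hc hc'
end

section
/- Almost surely (with respect to the completion of ℙ), the following holds simultaneously for every continuous function φ : ∂ → [0,1]: writing h(x) := 𝐄_x[φ(X_∞)] for the harmonic extension of φ, the sequence (⟨h, B̄_n⟩)_{n≥0} converges, and every subsequential weak limit W of the sequence of random finite measures (B̄_n)_{n≥0} on C satisfies ∫_∂ φ dW = lim_{n→∞} ⟨h, B̄_n⟩. In other words, the exceptional null set can be chosen uniformly over all continuous φ : ∂ → [0,1]. -/
open MeasureTheory Filter Topology

open scoped ENNReal NNReal

/-- The action of the transition kernel on non-negative functions. -/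
noncomputable def transitionOp {S : Type*} (P : S → S → ℝ) (v : S → ℝ≥0∞) : S → ℝ≥0∞ :=
  fun x => ∑' y, ENNReal.ofReal (P x y) * v y

/-- The pairing `⟨v, B̄ₙ⟩` of a non-negative function with the rescaled configuration. -/
noncomputable def rescaledPairing {S Ω : Type*} (m : ℝ) (B : ℕ → Ω → S → ℕ) (v : S → ℝ≥0∞)
    (n : ℕ) (ω : Ω) : ℝ≥0∞ :=
  ∑' x, v x * ENNReal.ofReal ((m ^ n)⁻¹ * (B n ω x : ℝ))

section BranchingRandomWalk

variable {S : Type*} {P : S → S → ℝ} {m : ℝ} {Ω : Type*} {mΩ : MeasurableSpace Ω}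
  {μ : Measure Ω} {F : Filtration ℕ mΩ} {B : ℕ → Ω → S → ℕ}

lemma measurable_rescaledPairing [Countable S]
    (hadapt : ∀ n x, Measurable[F n] (fun ω => B n ω x)) (v : S → ℝ≥0∞) (n : ℕ) :
    Measurable[F n] (rescaledPairing m B v n) := by
  let _ := F n
  change Measurable fun ω => ∑' x, v x * ENNReal.ofReal ((m ^ n)⁻¹ * (B n ω x : ℝ))
  refine Measurable.tsum fun x => ?_
  refine Measurable.const_mul ?_ _
  refine ENNReal.measurable_ofReal.comp ?_
  refine Measurable.const_mul ?_ _
  exact (measurable_from_top (f := fun k : ℕ => (k : ℝ))).comp (hadapt n x)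

lemma rescaledPairing_ne_top (hfin : ∀ n ω, (Function.support (B n ω)).Finite)
    {v : S → ℝ≥0∞} (hv : ∀ x, v x ≠ ∞) (n : ℕ) (ω : Ω) : rescaledPairing m B v n ω ≠ ∞ := by
  unfold rescaledPairing
  rw [tsum_eq_sum (s := (hfin n ω).toFinset)]
  · exact ENNReal.sum_ne_top.2 fun x _ => ENNReal.mul_ne_top (hv x) ENNReal.ofReal_ne_top
  · intro x hx
    have : B n ω x = 0 := by simpa using hx
    simp [this]

lemma setLIntegral_offspring [IsProbabilityMeasure μ] (hP0 : ∀ x y, 0 ≤ P x y) (hm : 0 ≤ m)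
    (hfin : ∀ n ω, (Function.support (B n ω)).Finite)
    (hint : ∀ n x, Integrable (fun ω => (B n ω x : ℝ)) μ)
    (hbranch : ∀ n x,
      μ[fun ω => (B (n + 1) ω x : ℝ)|F n]
        =ᵐ[μ] fun ω => m * ∑' y, (B n ω y : ℝ) * P y x)
    (n : ℕ) (x : S) {A : Set Ω} (hA : MeasurableSet[F n] A) :
    ∫⁻ ω in A, (B (n + 1) ω x : ℝ≥0∞) ∂μ
      = ∫⁻ ω in A, ENNReal.ofReal m * ∑' y, (B n ω y : ℝ≥0∞) * ENNReal.ofReal (P y x) ∂μ := by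
  have hsumm : ∀ ω, Summable fun y => (B n ω y : ℝ) * P y x := fun ω => by
    refine summable_of_hasFiniteSupport ((hfin n ω).subset fun y hy => ?_)
    contrapose! hy
    have : B n ω y = 0 := by simpa using hy
    simp [this]
  have h1 := setIntegral_condExp (F.le n) (hint (n + 1) x) hA
  rw [setIntegral_congr_ae ((F.le n) _ hA) ((hbranch n x).mono fun ω h _ => h)] at h1
  have hi : Integrable (fun ω => m * ∑' y, (B n ω y : ℝ) * P y x) μ :=
    integrable_condExp.congr (hbranch n x)
  have h2 := congrArg ENNReal.ofReal h1
  rw [ofReal_integral_eq_lintegral_ofReal hi.integrableOn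
      (ae_of_all _ fun ω => mul_nonneg hm (tsum_nonneg fun y =>
        mul_nonneg (Nat.cast_nonneg _) (hP0 y x))),
    ofReal_integral_eq_lintegral_ofReal (hint (n + 1) x).integrableOn
      (ae_of_all _ fun ω => Nat.cast_nonneg _)] at h2
  simp only [ENNReal.ofReal_natCast] at h2
  rw [← h2]
  refine lintegral_congr fun ω => ?_
  rw [ENNReal.ofReal_mul hm, ENNReal.ofReal_tsum_of_nonneg
    (fun y => mul_nonneg (Nat.cast_nonneg _) (hP0 y x)) (hsumm ω)]
  simp [ENNReal.ofReal_mul]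

lemma setLIntegral_rescaledPairing_succ [Countable S] [IsProbabilityMeasure μ]
    (hP0 : ∀ x y, 0 ≤ P x y) (hm : 0 < m)
    (hadapt : ∀ n x, Measurable[F n] (fun ω => B n ω x))
    (hfin : ∀ n ω, (Function.support (B n ω)).Finite)
    (hint : ∀ n x, Integrable (fun ω => (B n ω x : ℝ)) μ)
    (hbranch : ∀ n x,
      μ[fun ω => (B (n + 1) ω x : ℝ)|F n]
        =ᵐ[μ] fun ω => m * ∑' y, (B n ω y : ℝ) * P y x)
    (v : S → ℝ≥0∞) (n : ℕ) {A : Set Ω} (hA : MeasurableSet[F n] A) :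
    ∫⁻ ω in A, rescaledPairing m B v (n + 1) ω ∂μ
      = ∫⁻ ω in A, rescaledPairing m B (transitionOp P v) n ω ∂μ := by
  have hB : ∀ n x, Measurable fun ω => (B n ω x : ℝ≥0∞) := fun n x =>
    (measurable_from_top (f := fun k : ℕ => (k : ℝ≥0∞))).comp
      ((hadapt n x).mono (F.le n) le_rfl)
  have hmn : ∀ n, 0 ≤ (m ^ n)⁻¹ := fun n => by positivity
  have e : ∀ n, ENNReal.ofReal ((m ^ (n + 1))⁻¹) * ENNReal.ofReal m
      = ENNReal.ofReal ((m ^ n)⁻¹) := fun n => by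
    rw [← ENNReal.ofReal_mul (hmn _)]
    congr 1
    rw [pow_succ]
    field_simp
  simp only [rescaledPairing, transitionOp, ENNReal.ofReal_mul (hmn _), ENNReal.ofReal_natCast]
  rw [lintegral_tsum fun x => (((hB _ x).const_mul _).const_mul _).aemeasurable]
  have h1 : ∀ x, ∫⁻ ω in A, v x * (ENNReal.ofReal ((m ^ (n + 1))⁻¹) * (B (n + 1) ω x : ℝ≥0∞)) ∂μ
      = ∫⁻ ω in A, ∑' y, v x * (ENNReal.ofReal ((m ^ n)⁻¹) *
          ((B n ω y : ℝ≥0∞) * ENNReal.ofReal (P y x))) ∂μ := fun x => by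
    rw [lintegral_const_mul _ ((hB _ x).const_mul _), lintegral_const_mul _ (hB _ x),
      setLIntegral_offspring hP0 hm.le hfin hint hbranch n x hA,
      ← lintegral_const_mul, ← lintegral_const_mul]
    · refine lintegral_congr fun ω => ?_
      rw [ENNReal.tsum_mul_left, ENNReal.tsum_mul_left, ← e n]
      ring
    all_goals
      have : Measurable fun ω => ∑' y, (B n ω y : ℝ≥0∞) * ENNReal.ofReal (P y x) :=
        Measurable.tsum fun y => (hB _ y).mul_const _
      fun_prop
  simp_rw [h1]
  rw [← lintegral_tsum]
  · refine lintegral_congr fun ω => ?_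
    rw [ENNReal.tsum_comm]
    refine tsum_congr fun y => ?_
    rw [← ENNReal.tsum_mul_right]
    exact tsum_congr fun x => by ring
  · intro x
    refine (Measurable.tsum fun y => ?_).aemeasurable
    exact (((hB _ y).mul_const _).const_mul _).const_mul _

lemma lintegral_rescaledPairing [Countable S] [DecidableEq S] [IsProbabilityMeasure μ]
    (hP0 : ∀ x y, 0 ≤ P x y) (hm : 0 < m) {o : S}
    (hadapt : ∀ n x, Measurable[F n] (fun ω => B n ω x))
    (hfin : ∀ n ω, (Function.support (B n ω)).Finite)
    (hint : ∀ n x, Integrable (fun ω => (B n ω x : ℝ)) μ)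
    (hB0 : ∀ ω x, B 0 ω x = if x = o then 1 else 0)
    (hbranch : ∀ n x,
      μ[fun ω => (B (n + 1) ω x : ℝ)|F n]
        =ᵐ[μ] fun ω => m * ∑' y, (B n ω y : ℝ) * P y x)
    (v : S → ℝ≥0∞) (n : ℕ) :
    ∫⁻ ω, rescaledPairing m B v n ω ∂μ = (transitionOp P)^[n] v o := by
  induction n generalizing v with
  | zero =>
    have : ∀ ω, rescaledPairing m B v 0 ω = v o := fun ω => by
      unfold rescaledPairing
      rw [tsum_eq_single o]
      · simp [hB0]
      · intro x hx
        simp [hB0, hx]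
    simp [this]
  | succ n ih =>
    rw [Function.iterate_succ_apply, ← ih, ← setLIntegral_univ,
      setLIntegral_rescaledPairing_succ hP0 hm hadapt hfin hint hbranch v n MeasurableSet.univ,
      setLIntegral_univ]

lemma transitionOp_iterate_le {v : S → ℝ≥0∞} (hsup : transitionOp P v ≤ v) (n : ℕ) :
    (transitionOp P)^[n] v ≤ v := by
  have hmono : Monotone (transitionOp P) := fun u w h x =>
    ENNReal.tsum_le_tsum fun y => by gcongr; exact h y
  induction n with
  | zero => exact le_rfl
  | succ n ih =>
    rw [Function.iterate_succ_apply']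
    exact (hmono ih).trans hsup

/-- Pairing with a bounded superharmonic function converges almost surely. -/
lemma ae_exists_tendsto_rescaledPairing [Countable S] [DecidableEq S] [IsProbabilityMeasure μ]
    (hP0 : ∀ x y, 0 ≤ P x y) (hm : 0 < m) {o : S}
    (hadapt : ∀ n x, Measurable[F n] (fun ω => B n ω x))
    (hfin : ∀ n ω, (Function.support (B n ω)).Finite)
    (hint : ∀ n x, Integrable (fun ω => (B n ω x : ℝ)) μ)
    (hB0 : ∀ ω x, B 0 ω x = if x = o then 1 else 0)
    (hbranch : ∀ n x,
      μ[fun ω => (B (n + 1) ω x : ℝ)|F n]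
        =ᵐ[μ] fun ω => m * ∑' y, (B n ω y : ℝ) * P y x)
    {v : S → ℝ≥0∞} (hv : ∀ x, v x ≠ ∞) (hsup : transitionOp P v ≤ v) :
    ∀ᵐ ω ∂μ, ∃ L : ℝ, Tendsto (fun n => (rescaledPairing m B v n ω).toReal) atTop (𝓝 L) := by
  have hmeas : ∀ n, Measurable (rescaledPairing m B v n) := fun n =>
    (measurable_rescaledPairing hadapt v n).mono (F.le n) le_rfl
  have hlint : ∀ n, ∫⁻ ω, rescaledPairing m B v n ω ∂μ ≤ v o := fun n => by
    rw [lintegral_rescaledPairing hP0 hm hadapt hfin hint hB0 hbranch]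
    exact transitionOp_iterate_le hsup n o
  have hlint' : ∀ n, ∫⁻ ω, rescaledPairing m B v n ω ∂μ ≠ ∞ := fun n =>
    ne_top_of_le_ne_top (hv o) (hlint n)
  have hZ : ∀ n ω, rescaledPairing m B v n ω ≠ ∞ := fun n ω => rescaledPairing_ne_top hfin hv n ω
  have hI : ∀ n, Integrable (fun ω => (rescaledPairing m B v n ω).toReal) μ := fun n =>
    integrable_toReal_of_lintegral_ne_top (hmeas n).aemeasurable (hlint' n)
  have hsub : Submartingale (fun n ω => -(rescaledPairing m B v n ω).toReal) F μ := by
    refine submartingale_of_setIntegral_le_succ ?_ (fun n => (hI n).neg) ?_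
    · exact fun n =>
        (measurable_rescaledPairing hadapt v n).ennreal_toReal.neg.stronglyMeasurable
    · intro n A hA
      rw [integral_neg, integral_neg, neg_le_neg_iff,
        integral_toReal (hmeas _).aemeasurable (ae_of_all _ fun ω => (hZ _ ω).lt_top),
        integral_toReal (hmeas _).aemeasurable (ae_of_all _ fun ω => (hZ _ ω).lt_top)]
      refine ENNReal.toReal_mono
        (ne_top_of_le_ne_top (hlint' n) (setLIntegral_le_lintegral _ _)) ?_
      rw [setLIntegral_rescaledPairing_succ hP0 hm hadapt hfin hint hbranch v n hA]
      refine lintegral_mono fun ω => ENNReal.tsum_le_tsum fun x => ?_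
      gcongr
      exact hsup x
  have hbdd : ∀ n, eLpNorm (fun ω => -(rescaledPairing m B v n ω).toReal) 1 μ
      ≤ ((v o).toNNReal : ℝ≥0) := fun n => by
    rw [ENNReal.coe_toNNReal (hv o), eLpNorm_one_eq_lintegral_enorm]
    refine le_trans (lintegral_mono fun ω => ?_) (hlint n)
    rw [enorm_neg, Real.enorm_eq_ofReal ENNReal.toReal_nonneg, ENNReal.ofReal_toReal (hZ n ω)]
  filter_upwards [hsub.exists_ae_tendsto_of_bdd hbdd] with ω ⟨c, hc⟩
  exact ⟨-c, by simpa using hc.neg⟩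

/-- Pairing with a bounded potential-like superharmonic function vanishes almost surely. -/
lemma ae_tendsto_zero_rescaledPairing [Countable S] [DecidableEq S] [IsProbabilityMeasure μ]
    (hP0 : ∀ x y, 0 ≤ P x y) (hm : 0 < m) {o : S}
    (hadapt : ∀ n x, Measurable[F n] (fun ω => B n ω x))
    (hfin : ∀ n ω, (Function.support (B n ω)).Finite)
    (hint : ∀ n x, Integrable (fun ω => (B n ω x : ℝ)) μ)
    (hB0 : ∀ ω x, B 0 ω x = if x = o then 1 else 0)
    (hbranch : ∀ n x,
      μ[fun ω => (B (n + 1) ω x : ℝ)|F n]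
        =ᵐ[μ] fun ω => m * ∑' y, (B n ω y : ℝ) * P y x)
    {v : S → ℝ≥0∞} (hv : ∀ x, v x ≠ ∞) (hsup : transitionOp P v ≤ v)
    (hlim : Tendsto (fun n => (transitionOp P)^[n] v o) atTop (𝓝 0)) :
    ∀ᵐ ω ∂μ, Tendsto (fun n => (rescaledPairing m B v n ω).toReal) atTop (𝓝 0) := by
  have hmeas : ∀ n, Measurable (rescaledPairing m B v n) := fun n =>
    (measurable_rescaledPairing hadapt v n).mono (F.le n) le_rfl
  have hfatou : ∫⁻ ω, liminf (fun n => rescaledPairing m B v n ω) atTop ∂μ = 0 := by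
    refine le_antisymm ((lintegral_liminf_le hmeas).trans ?_) zero_le
    simp_rw [lintegral_rescaledPairing hP0 hm hadapt hfin hint hB0 hbranch]
    exact hlim.liminf_eq.le
  rw [lintegral_eq_zero_iff (Measurable.liminf hmeas)] at hfatou
  filter_upwards [hfatou,
    ae_exists_tendsto_rescaledPairing hP0 hm hadapt hfin hint hB0 hbranch hv hsup] with ω h0 ⟨L, hL⟩
  have hL' : Tendsto (fun n => rescaledPairing m B v n ω) atTop (𝓝 (ENNReal.ofReal L)) := by
    refine (ENNReal.tendsto_ofReal hL).congr fun n => ?_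
    exact ENNReal.ofReal_toReal (rescaledPairing_ne_top hfin hv n ω)
  rw [hL'.liminf_eq] at h0
  have hLn : 0 ≤ L := ge_of_tendsto' hL fun n => ENNReal.toReal_nonneg
  have : L = 0 := le_antisymm (ENNReal.ofReal_eq_zero.1 h0) hLn
  rwa [this] at hL

end BranchingRandomWalk

section MarkovChain

variable {S : Type*} [Countable S] [MeasurableSpace S] [MeasurableSingletonClass S]

/-- Finite measures on path space are determined by the cylinder sets. -/
lemma pathMeasure_ext {μ ν : Measure (ℕ → S)} [IsFiniteMeasure μ] [IsFiniteMeasure ν]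
    (h : ∀ (n : ℕ) (s : ℕ → S), μ {ω | ∀ i ≤ n, ω i = s i} = ν {ω | ∀ i ≤ n, ω i = s i}) :
    μ = ν := by
  have hν : IsProjectiveLimit ν (fun I : Finset ℕ => ν.map I.restrict) := fun I => rfl
  refine IsProjectiveLimit.unique (P := fun I : Finset ℕ => ν.map I.restrict) ?_ hν
  have hfam : IsProjectiveMeasureFamily (fun I : Finset ℕ => ν.map I.restrict) := by
    intro I J hJI
    rw [Measure.map_map (by fun_prop) (by fun_prop)]
    rfl
  rw [isProjectiveLimit_nat_iff hfam]
  intro n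
  refine Measure.ext_of_singleton fun a => ?_
  have e : ∀ ρ : Measure (ℕ → S), ρ.map (Preorder.frestrictLe n) {a}
      = ρ {ω | ∀ i ≤ n, ω i = a ⟨min i n, by simp⟩} := fun ρ => by
    rw [Measure.map_apply (by fun_prop) (measurableSet_singleton a)]
    congr 1
    ext ω
    simp only [Set.mem_preimage, Set.mem_singleton_iff, Set.mem_ofPred_eq, funext_iff,
      Subtype.forall, Finset.mem_Iic]
    refine forall₂_congr fun i hi => ?_
    simp [min_eq_left hi]
  exact (e μ).trans ((h n _).trans (e ν).symm)

variable [DecidableEq S] {P : S → S → ℝ} {Q : S → Measure (ℕ → S)}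

lemma ae_path_zero_eq (hQprob : ∀ x, IsProbabilityMeasure (Q x))
    (hQcyl : ∀ (x : S) (n : ℕ) (s : ℕ → S),
      Q x {ω | ∀ i ≤ n, ω i = s i} =
        (if s 0 = x then 1 else 0) *
          ∏ i ∈ Finset.range n, ENNReal.ofReal (P (s i) (s (i + 1)))) (x : S) :
    ∀ᵐ ω ∂(Q x), ω 0 = x := by
  have h := hQcyl x 0 fun _ => x
  have hs : MeasurableSet {ω : ℕ → S | ω 0 = x} :=
    measurableSet_eq_fun (measurable_pi_apply 0) measurable_const
  rw [ae_iff_prob_eq_one]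
  · simpa using h
  · exact measurableSet_setOfPred.1 hs

/-- The Markov property at time one. -/
lemma map_shift_eq_sum (hP1 : ∀ x, HasSum (fun y => P x y) 1) (hP0 : ∀ x y, 0 ≤ P x y)
    (hQprob : ∀ x, IsProbabilityMeasure (Q x))
    (hQcyl : ∀ (x : S) (n : ℕ) (s : ℕ → S),
      Q x {ω | ∀ i ≤ n, ω i = s i} =
        (if s 0 = x then 1 else 0) *
          ∏ i ∈ Finset.range n, ENNReal.ofReal (P (s i) (s (i + 1)))) (x : S) :
    (Q x).map (fun ω k => ω (k + 1))
      = Measure.sum fun y => ENNReal.ofReal (P x y) • Q y := by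
  have hshift : Measurable fun (ω : ℕ → S) (k : ℕ) => ω (k + 1) := by fun_prop
  have hcyl : ∀ (n : ℕ) (s : ℕ → S), MeasurableSet {ω : ℕ → S | ∀ i ≤ n, ω i = s i} :=
    fun n s => by
      simp only [Set.ofPred_forall]
      exact MeasurableSet.iInter fun i => MeasurableSet.iInter fun _ =>
        measurableSet_eq_fun (measurable_pi_apply i) measurable_const
  have : IsFiniteMeasure (Measure.sum fun y => ENNReal.ofReal (P x y) • Q y) := ⟨by
    rw [Measure.sum_apply _ MeasurableSet.univ]
    simp only [Measure.smul_apply, measure_univ, smul_eq_mul, mul_one]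
    rw [← ENNReal.ofReal_tsum_of_nonneg (hP0 x) (hP1 x).summable]
    exact ENNReal.ofReal_lt_top⟩
  refine pathMeasure_ext fun n s => ?_
  rw [Measure.map_apply hshift (hcyl n s), Measure.sum_apply _ (hcyl n s)]
  simp only [Measure.smul_apply, smul_eq_mul, hQcyl]
  rw [tsum_eq_single (s 0) fun y hy => by simp [hy.symm]]
  let s' : ℕ → S := fun k => Nat.casesOn k x s
  have h1 : Q x ((fun (ω : ℕ → S) (k : ℕ) => ω (k + 1)) ⁻¹' {ω | ∀ i ≤ n, ω i = s i})
      = Q x {ω | ∀ i ≤ n + 1, ω i = s' i} := by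
    refine measure_congr ?_
    filter_upwards [ae_path_zero_eq hQprob hQcyl x] with ω hω
    refine propext ⟨fun h i hi => ?_, fun h i hi => h (i + 1) (by omega)⟩
    cases i with
    | zero => exact hω
    | succ i => exact h i (by omega)
  rw [h1, hQcyl, Finset.prod_range_succ']
  simp [s', mul_comm]

lemma transitionOp_lintegral (hP1 : ∀ x, HasSum (fun y => P x y) 1) (hP0 : ∀ x y, 0 ≤ P x y)
    (hQprob : ∀ x, IsProbabilityMeasure (Q x))
    (hQcyl : ∀ (x : S) (n : ℕ) (s : ℕ → S),
      Q x {ω | ∀ i ≤ n, ω i = s i} =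
        (if s 0 = x then 1 else 0) *
          ∏ i ∈ Finset.range n, ENNReal.ofReal (P (s i) (s (i + 1))))
    {G : (ℕ → S) → ℝ≥0∞} (hG : Measurable G) :
    transitionOp P (fun x => ∫⁻ ω, G ω ∂(Q x)) = fun x => ∫⁻ ω, G (fun k => ω (k + 1)) ∂(Q x) := by
  funext x
  have hshift : Measurable fun (ω : ℕ → S) (k : ℕ) => ω (k + 1) := by fun_prop
  rw [← lintegral_map hG hshift, map_shift_eq_sum hP1 hP0 hQprob hQcyl, lintegral_sum_measure]
  simp [transitionOp, lintegral_smul_measure]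

lemma transitionOp_iterate_lintegral
    (hP1 : ∀ x, HasSum (fun y => P x y) 1) (hP0 : ∀ x y, 0 ≤ P x y)
    (hQprob : ∀ x, IsProbabilityMeasure (Q x))
    (hQcyl : ∀ (x : S) (n : ℕ) (s : ℕ → S),
      Q x {ω | ∀ i ≤ n, ω i = s i} =
        (if s 0 = x then 1 else 0) *
          ∏ i ∈ Finset.range n, ENNReal.ofReal (P (s i) (s (i + 1))))
    {G : (ℕ → S) → ℝ≥0∞} (hG : Measurable G) (n : ℕ) :
    (transitionOp P)^[n] (fun x => ∫⁻ ω, G ω ∂(Q x))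
      = fun x => ∫⁻ ω, G (fun k => ω (k + n)) ∂(Q x) := by
  induction n with
  | zero => rfl
  | succ n ih =>
    have hshift : Measurable fun (ω : ℕ → S) (k : ℕ) => ω (k + n) := by fun_prop
    rw [Function.iterate_succ_apply', ih]
    refine (transitionOp_lintegral hP1 hP0 hQprob hQcyl (hG.comp hshift)).trans ?_
    simp [add_assoc]

end MarkovChain

section PathOscillation

variable {S : Type*}

/-- The oscillation of a function along a trajectory. -/
noncomputable def pathOscillation (f : S → ℝ≥0) (ω : ℕ → S) : ℝ≥0∞ :=
  ⨆ j, ⨆ k, edist (f (ω j)) (f (ω k))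

lemma measurable_pathOscillation [MeasurableSpace S] [DiscreteMeasurableSpace S] (f : S → ℝ≥0) :
    Measurable (pathOscillation f) := by
  have hf : Measurable f := .of_discrete
  unfold pathOscillation
  exact Measurable.iSup fun j => Measurable.iSup fun k =>
    (hf.comp (measurable_pi_apply j)).edist (hf.comp (measurable_pi_apply k))

lemma pathOscillation_shift_le (f : S → ℝ≥0) (ω : ℕ → S) (n : ℕ) :
    pathOscillation f (fun k => ω (k + n)) ≤ pathOscillation f ω :=
  iSup₂_le fun j k =>
    le_iSup₂ (f := fun j k => edist (f (ω j)) (f (ω k))) (j + n) (k + n)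

lemma pathOscillation_le {f : S → ℝ≥0} {K : ℝ≥0} (hf : ∀ x, f x ≤ K) (ω : ℕ → S) :
    pathOscillation f ω ≤ K := by
  refine iSup₂_le fun j k => ?_
  rw [edist_nndist, ENNReal.coe_le_coe, NNReal.nndist_eq]
  exact max_le (tsub_le_self.trans (hf _)) (tsub_le_self.trans (hf _))

lemma edist_le_pathOscillation {f : S → ℝ≥0} {ω : ℕ → S} {a : ℝ≥0}
    (h : Tendsto (fun n => f (ω n)) atTop (𝓝 a)) :
    edist a (f (ω 0)) ≤ pathOscillation f ω :=
  le_of_tendsto' (h.edist tendsto_const_nhds) fun n =>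
    le_iSup₂ (f := fun j k => edist (f (ω j)) (f (ω k))) n 0

lemma tendsto_pathOscillation_shift {f : S → ℝ≥0} {ω : ℕ → S}
    (h : CauchySeq fun n => f (ω n)) :
    Tendsto (fun n => pathOscillation f fun k => ω (k + n)) atTop (𝓝 0) := by
  rw [ENNReal.tendsto_nhds_zero]
  intro ε hε
  obtain ⟨N, hN⟩ := EMetric.cauchySeq_iff.1 h ε hε
  filter_upwards [eventually_ge_atTop N] with n hn
  exact iSup₂_le fun j k => (hN _ (by omega) _ (by omega)).le

end PathOscillation

lemma exists_forall_le_of_compact {C : Type*} [TopologicalSpace C] [CompactSpace C]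
    (ψ : C(C, ℝ≥0)) : ∃ K : ℝ≥0, ∀ c, ψ c ≤ K := by
  obtain ⟨K, hK⟩ := (isCompact_range ψ.continuous).bddAbove
  exact ⟨K, fun c => hK ⟨c, rfl⟩⟩

section BoundaryIntegrals

variable {S : Type*} [MeasurableSpace S] {Q : S → Measure (ℕ → S)}
  {C : Type*} [TopologicalSpace C] [CompactSpace C] [MeasurableSpace C] [BorelSpace C]
  {Xinf : (ℕ → S) → C}

lemma integrable_boundary
    (hQprob : ∀ x, IsProbabilityMeasure (Q x)) (hXmeas : Measurable Xinf)
    (ψ : C(C, ℝ≥0)) (x : S) : Integrable (fun ω => (ψ (Xinf ω) : ℝ)) (Q x) := by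
  obtain ⟨K, hK⟩ := exists_forall_le_of_compact ψ
  refine Integrable.of_bound (C := K) ?_ (ae_of_all _ fun ω => ?_)
  · exact (ψ.continuous.measurable.comp hXmeas).coe_nnreal_real.aestronglyMeasurable
  · simpa using hK _

lemma abs_boundaryExtension_sub_le_dist
    (hQprob : ∀ x, IsProbabilityMeasure (Q x)) (hXmeas : Measurable Xinf)
    (ψ ψ' : C(C, ℝ≥0)) (x : S) :
    |∫ ω, (ψ (Xinf ω) : ℝ) ∂(Q x) - ∫ ω, (ψ' (Xinf ω) : ℝ) ∂(Q x)| ≤ dist ψ ψ' := by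
  rw [← integral_sub (integrable_boundary hQprob hXmeas ψ x)
    (integrable_boundary hQprob hXmeas ψ' x), ← Real.norm_eq_abs]
  refine (norm_integral_le_of_norm_le_const (C := dist ψ ψ') (ae_of_all _ fun ω => ?_)).trans ?_
  · exact ContinuousMap.dist_apply_le_dist (f := ψ) (g := ψ') (Xinf ω)
  · simp

end BoundaryIntegrals

section BoundaryFunctions

variable {S : Type*} [Countable S] [MeasurableSpace S] [MeasurableSingletonClass S]
  [DecidableEq S] {P : S → S → ℝ} {Q : S → Measure (ℕ → S)}
  {C : Type*} [TopologicalSpace C] {ι : S → C} {Xinf : (ℕ → S) → C}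

/-- The extension of a boundary function to the state space is superharmonic. -/
lemma transitionOp_boundaryExtension_le
    (hP1 : ∀ x, HasSum (fun y => P x y) 1) (hP0 : ∀ x y, 0 ≤ P x y)
    (hQprob : ∀ x, IsProbabilityMeasure (Q x))
    (hQcyl : ∀ (x : S) (n : ℕ) (s : ℕ → S),
      Q x {ω | ∀ i ≤ n, ω i = s i} =
        (if s 0 = x then 1 else 0) *
          ∏ i ∈ Finset.range n, ENNReal.ofReal (P (s i) (s (i + 1))))
    (hlim : ∀ x : S, ∀ᵐ ω ∂(Q x), Tendsto (fun n => ι (ω n)) atTop (𝓝 (Xinf ω)))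
    (ψ : C(C, ℝ≥0)) :
    transitionOp P (fun x => ∫⁻ ω, (ψ (Xinf ω) : ℝ≥0∞) ∂(Q x))
      ≤ fun x => ∫⁻ ω, (ψ (Xinf ω) : ℝ≥0∞) ∂(Q x) := by
  let G : (ℕ → S) → ℝ≥0∞ := fun ω => liminf (fun n => (ψ (ι (ω n)) : ℝ≥0∞)) atTop
  have hG : Measurable G := Measurable.liminf fun n =>
    (Measurable.of_discrete (f := fun x : S => (ψ (ι x) : ℝ≥0∞))).comp (measurable_pi_apply n)
  have e : (fun x => ∫⁻ ω, (ψ (Xinf ω) : ℝ≥0∞) ∂(Q x)) = fun x => ∫⁻ ω, G ω ∂(Q x) := by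
    funext x
    refine lintegral_congr_ae ((hlim x).mono fun ω hω => ?_)
    have : Tendsto (fun n => (ψ (ι (ω n)) : ℝ≥0∞)) atTop (𝓝 (ψ (Xinf ω))) :=
      ENNReal.tendsto_coe.2 ((ψ.continuous.tendsto _).comp hω)
    exact this.liminf_eq.symm
  rw [e, transitionOp_lintegral hP1 hP0 hQprob hQcyl hG]
  refine le_of_eq (funext fun x => lintegral_congr fun ω => ?_)
  exact liminf_nat_add (fun n => (ψ (ι (ω n)) : ℝ≥0∞)) 1

lemma transitionOp_lintegral_pathOscillation_le
    (hP1 : ∀ x, HasSum (fun y => P x y) 1) (hP0 : ∀ x y, 0 ≤ P x y)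
    (hQprob : ∀ x, IsProbabilityMeasure (Q x))
    (hQcyl : ∀ (x : S) (n : ℕ) (s : ℕ → S),
      Q x {ω | ∀ i ≤ n, ω i = s i} =
        (if s 0 = x then 1 else 0) *
          ∏ i ∈ Finset.range n, ENNReal.ofReal (P (s i) (s (i + 1))))
    (f : S → ℝ≥0) :
    transitionOp P (fun x => ∫⁻ ω, pathOscillation f ω ∂(Q x))
      ≤ fun x => ∫⁻ ω, pathOscillation f ω ∂(Q x) := by
  rw [transitionOp_lintegral hP1 hP0 hQprob hQcyl (measurable_pathOscillation f)]
  exact fun x => lintegral_mono fun ω => pathOscillation_shift_le f ω 1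

lemma tendsto_iterate_lintegral_pathOscillation [CompactSpace C]
    (hP1 : ∀ x, HasSum (fun y => P x y) 1) (hP0 : ∀ x y, 0 ≤ P x y)
    (hQprob : ∀ x, IsProbabilityMeasure (Q x))
    (hQcyl : ∀ (x : S) (n : ℕ) (s : ℕ → S),
      Q x {ω | ∀ i ≤ n, ω i = s i} =
        (if s 0 = x then 1 else 0) *
          ∏ i ∈ Finset.range n, ENNReal.ofReal (P (s i) (s (i + 1))))
    (hlim : ∀ x : S, ∀ᵐ ω ∂(Q x), Tendsto (fun n => ι (ω n)) atTop (𝓝 (Xinf ω)))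
    (ψ : C(C, ℝ≥0)) (x : S) :
    Tendsto (fun n => (transitionOp P)^[n]
      (fun x => ∫⁻ ω, pathOscillation (ψ ∘ ι) ω ∂(Q x)) x) atTop (𝓝 0) := by
  have hmeas := measurable_pathOscillation (ψ ∘ ι)
  obtain ⟨K, hK⟩ := exists_forall_le_of_compact ψ
  simp_rw [transitionOp_iterate_lintegral hP1 hP0 hQprob hQcyl hmeas]
  have h := tendsto_lintegral_of_dominated_convergence (μ := Q x)
    (F := fun n ω => pathOscillation (ψ ∘ ι) fun k => ω (k + n)) (f := fun _ => 0)
    (fun _ => (K : ℝ≥0∞)) (fun n => hmeas.comp (by fun_prop))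
    (fun n => ae_of_all _ fun ω => pathOscillation_le (fun y => hK (ι y)) _)
    (by simp) ?_
  · simpa using h
  · filter_upwards [hlim x] with ω hω
    exact tendsto_pathOscillation_shift ((ψ.continuous.tendsto _).comp hω).cauchySeq

lemma abs_boundaryExtension_sub_le [CompactSpace C] [MeasurableSpace C] [BorelSpace C]
    (hQprob : ∀ x, IsProbabilityMeasure (Q x))
    (hQcyl : ∀ (x : S) (n : ℕ) (s : ℕ → S),
      Q x {ω | ∀ i ≤ n, ω i = s i} =
        (if s 0 = x then 1 else 0) *
          ∏ i ∈ Finset.range n, ENNReal.ofReal (P (s i) (s (i + 1))))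
    (hXmeas : Measurable Xinf)
    (hlim : ∀ x : S, ∀ᵐ ω ∂(Q x), Tendsto (fun n => ι (ω n)) atTop (𝓝 (Xinf ω)))
    (ψ : C(C, ℝ≥0)) (x : S) :
    |∫ ω, (ψ (Xinf ω) : ℝ) ∂(Q x) - ψ (ι x)|
      ≤ (∫⁻ ω, pathOscillation (ψ ∘ ι) ω ∂(Q x)).toReal := by
  obtain ⟨K, hK⟩ := exists_forall_le_of_compact ψ
  have hconst : ∫ _, (ψ (ι x) : ℝ) ∂(Q x) = ψ (ι x) := by simp
  have hfin : ∫⁻ ω, pathOscillation (ψ ∘ ι) ω ∂(Q x) ≠ ∞ := by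
    refine ne_top_of_le_ne_top (b := (K : ℝ≥0∞)) ENNReal.coe_ne_top ?_
    refine (lintegral_mono fun ω => pathOscillation_le (fun y => hK (ι y)) ω).trans ?_
    simp
  rw [← hconst, ← integral_sub (integrable_boundary hQprob hXmeas ψ x) (integrable_const _),
    ← Real.norm_eq_abs, ← toReal_enorm]
  refine ENNReal.toReal_mono hfin ((enorm_integral_le_lintegral_enorm _).trans ?_)
  refine lintegral_mono_ae ?_
  filter_upwards [hlim x, ae_path_zero_eq hQprob hQcyl x] with ω hω h0
  have := edist_le_pathOscillation (f := ψ ∘ ι) ((ψ.continuous.tendsto _).comp hω)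
  rw [h0] at this
  exact this

end BoundaryFunctions

section RealPairing

variable {S Ω : Type*} {m : ℝ} {B : ℕ → Ω → S → ℕ}

/-- The pairing `⟨f, B̄ₙ⟩` of a real function with the rescaled configuration. -/
noncomputable def realPairing (m : ℝ) (B : ℕ → Ω → S → ℕ) (f : S → ℝ) (n : ℕ) (ω : Ω) : ℝ :=
  (m ^ n)⁻¹ * ∑' x, f x * (B n ω x : ℝ)

lemma summable_mul_config (hfin : ∀ n ω, (Function.support (B n ω)).Finite) (f : S → ℝ) (n : ℕ)
    (ω : Ω) : Summable fun x => f x * (B n ω x : ℝ) := by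
  refine summable_of_hasFiniteSupport ((hfin n ω).subset fun y hy => ?_)
  contrapose! hy
  have : B n ω y = 0 := by simpa using hy
  simp [this]

lemma toReal_rescaledPairing (hm : 0 ≤ m)
    {v : S → ℝ≥0∞} (hv : ∀ x, v x ≠ ∞) (n : ℕ) (ω : Ω) :
    (rescaledPairing m B v n ω).toReal = realPairing m B (fun x => (v x).toReal) n ω := by
  rw [rescaledPairing, ENNReal.tsum_toReal_eq
    fun x => ENNReal.mul_ne_top (hv x) ENNReal.ofReal_ne_top, realPairing, ← tsum_mul_left]
  refine tsum_congr fun x => ?_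
  rw [ENNReal.toReal_mul, ENNReal.toReal_ofReal (by positivity)]
  ring

lemma abs_realPairing_sub_le (hm : 0 ≤ m) (hfin : ∀ n ω, (Function.support (B n ω)).Finite)
    {f g r : S → ℝ} {c : ℝ} (h : ∀ x, |f x - g x| ≤ c + r x) (n : ℕ) (ω : Ω) :
    |realPairing m B f n ω - realPairing m B g n ω|
      ≤ c * realPairing m B 1 n ω + realPairing m B r n ω := by
  have hs := fun f => summable_mul_config hfin f n ω
  have hmn : 0 ≤ (m ^ n)⁻¹ := by positivity
  have hfg : realPairing m B f n ω - realPairing m B g n ω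
      = (m ^ n)⁻¹ * ∑' x, (f x * (B n ω x : ℝ) - g x * (B n ω x : ℝ)) := by
    rw [(hs f).tsum_sub (hs g), mul_sub]
    rfl
  have hcr : c * realPairing m B 1 n ω + realPairing m B r n ω
      = (m ^ n)⁻¹ * ∑' x, (c * ((1 : S → ℝ) x * (B n ω x : ℝ)) + r x * (B n ω x : ℝ)) := by
    rw [((hs 1).mul_left c).tsum_add (hs r), tsum_mul_left, mul_add, mul_left_comm]
    rfl
  have hle : ∀ x, |f x * (B n ω x : ℝ) - g x * (B n ω x : ℝ)|
      ≤ c * ((1 : S → ℝ) x * (B n ω x : ℝ)) + r x * (B n ω x : ℝ) := fun x => by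
    rw [← sub_mul, abs_mul, Nat.abs_cast, Pi.one_apply, one_mul, ← add_mul]
    exact mul_le_mul_of_nonneg_right (h x) (Nat.cast_nonneg _)
  have habs : Summable fun x => |f x * (B n ω x : ℝ) - g x * (B n ω x : ℝ)| :=
    ((hs f).sub (hs g)).abs
  rw [hfg, hcr, abs_mul, abs_of_nonneg hmn]
  refine mul_le_mul_of_nonneg_left ?_ hmn
  have hnorm := norm_tsum_le_tsum_norm
    (f := fun x => f x * (B n ω x : ℝ) - g x * (B n ω x : ℝ)) ((hs f).sub (hs g)).norm
  simp only [Real.norm_eq_abs] at hnorm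
  have hsum : Summable fun x => c * ((1 : S → ℝ) x * (B n ω x : ℝ)) + r x * (B n ω x : ℝ) :=
    ((hs 1).mul_left c).add (hs r)
  exact hnorm.trans (Summable.tsum_le_tsum hle habs hsum)

/-- Convergence of pairings extends from a dense family of test functions to all of them. -/
lemma exists_common_limit_of_dense (hm : 0 ≤ m)
    (hfin : ∀ n ω, (Function.support (B n ω)).Finite) {ω : Ω}
    {E : Type*} [PseudoMetricSpace E] {s : Set E} (hs : Dense s) {H J r : E → S → ℝ}
    (hH : ∀ ψ ψ' x, |H ψ x - H ψ' x| ≤ dist ψ ψ') (hJ : ∀ ψ ψ' x, |J ψ x - J ψ' x| ≤ dist ψ ψ')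
    (hr : ∀ ψ x, |H ψ x - J ψ x| ≤ r ψ x)
    (hone : ∃ T, ∀ n, realPairing m B 1 n ω ≤ T)
    (hHs : ∀ ψ ∈ s, ∃ L, Tendsto (fun n => realPairing m B (H ψ) n ω) atTop (𝓝 L))
    (hrs : ∀ ψ ∈ s, Tendsto (fun n => realPairing m B (r ψ) n ω) atTop (𝓝 0)) (ψ : E) :
    ∃ L, Tendsto (fun n => realPairing m B (H ψ) n ω) atTop (𝓝 L) ∧
      Tendsto (fun n => realPairing m B (J ψ) n ω) atTop (𝓝 L) := by
  obtain ⟨T, hT⟩ := hone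
  have hone0 : ∀ n, 0 ≤ realPairing m B 1 n ω := fun n =>
    mul_nonneg (by positivity) (tsum_nonneg fun x => by simp)
  have hT0 : 0 ≤ T := (hone0 0).trans (hT 0)
  have hzero : ∀ n, realPairing m B (0 : S → ℝ) n ω = 0 := fun n => by simp [realPairing]
  have approx : ∀ ε > 0, ∃ ψ' ∈ s, dist ψ ψ' * T < ε := fun ε hε => by
    obtain ⟨ψ', hψ', hd⟩ := hs.exists_dist_lt ψ (ε := ε / (T + 1)) (by positivity)
    refine ⟨ψ', hψ', ?_⟩
    rw [lt_div_iff₀ (by positivity)] at hd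
    nlinarith [dist_nonneg (x := ψ) (y := ψ')]
  have hHd : ∀ ψ' n, |realPairing m B (H ψ) n ω - realPairing m B (H ψ') n ω|
      ≤ dist ψ ψ' * T := fun ψ' n => by
    refine (abs_realPairing_sub_le hm hfin (r := 0) (fun x => by simpa using hH ψ ψ' x) n ω).trans ?_
    rw [hzero, add_zero]
    exact mul_le_mul_of_nonneg_left (hT n) dist_nonneg
  have hcauchy : CauchySeq fun n => realPairing m B (H ψ) n ω := by
    rw [Metric.cauchySeq_iff]
    intro ε hε
    obtain ⟨ψ', hψ', hd⟩ := approx (ε / 3) (by positivity)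
    obtain ⟨L, hL⟩ := hHs ψ' hψ'
    obtain ⟨N, hN⟩ := Metric.cauchySeq_iff.1 hL.cauchySeq (ε / 3) (by positivity)
    refine ⟨N, fun i hi j hj => ?_⟩
    have h1 := abs_le.1 (hHd ψ' i)
    have h2 := abs_le.1 (hHd ψ' j)
    have h3 := abs_lt.1 (Real.dist_eq _ _ ▸ hN i hi j hj)
    rw [Real.dist_eq, abs_lt]
    constructor <;> linarith [h1.1, h1.2, h2.1, h2.2, h3.1, h3.2]
  obtain ⟨L, hL⟩ := cauchySeq_tendsto_of_complete hcauchy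
  refine ⟨L, hL, ?_⟩
  have hdiff : Tendsto (fun n => realPairing m B (J ψ) n ω - realPairing m B (H ψ) n ω)
      atTop (𝓝 0) := by
    rw [Metric.tendsto_atTop]
    intro ε hε
    obtain ⟨ψ', hψ', hd⟩ := approx (ε / 4) (by positivity)
    obtain ⟨N, hN⟩ := Metric.tendsto_atTop.1 (hrs ψ' hψ') (ε / 2) (by positivity)
    refine ⟨N, fun n hn => ?_⟩
    have h1 : ∀ x, |J ψ x - H ψ x| ≤ 2 * dist ψ ψ' + r ψ' x := fun x => by
      have a := abs_le.1 (hH ψ ψ' x)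
      have b := abs_le.1 (hJ ψ ψ' x)
      have c := abs_le.1 (hr ψ' x)
      rw [abs_le]
      constructor <;> linarith [a.1, a.2, b.1, b.2, c.1, c.2]
    have h2 := abs_realPairing_sub_le hm hfin h1 n ω
    have h3 := mul_le_mul_of_nonneg_left (hT n) (dist_nonneg (x := ψ) (y := ψ'))
    have h4 := hN n hn
    rw [Real.dist_eq, sub_zero] at h4 ⊢
    linarith [le_abs_self (realPairing m B (r ψ') n ω)]
  simpa using hdiff.add hL

end RealPairing

section WeakLimits

variable {S Ω C : Type*} {m : ℝ} {B : ℕ → Ω → S → ℕ} [TopologicalSpace C]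
  [MeasurableSpace C] [BorelSpace C] {ι : S → C}

lemma integral_brwMeasure (hm : 0 ≤ m) (ψ : C(C, ℝ≥0)) (n : ℕ) (ω : Ω) :
    ∫ c, (ψ c : ℝ) ∂(brwMeasure ι fun x => ENNReal.ofReal ((m ^ n)⁻¹ * (B n ω x : ℝ)))
      = realPairing m B (fun x => (ψ (ι x) : ℝ)) n ω := by
  have hmeas : Measurable ψ := ψ.continuous.measurable
  rw [integral_eq_lintegral_of_nonneg_ae (ae_of_all _ fun c => NNReal.coe_nonneg _)
    hmeas.coe_nnreal_real.aestronglyMeasurable, brwMeasure, lintegral_sum_measure]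
  simp only [lintegral_smul_measure, ENNReal.ofReal_coe_nnreal]
  simp only [lintegral_dirac' _ hmeas.coe_nnreal_ennreal, smul_eq_mul]
  have := toReal_rescaledPairing (B := B) (m := m) hm (v := fun x => (ψ (ι x) : ℝ≥0∞))
    (fun x => ENNReal.coe_ne_top) n ω
  simpa [rescaledPairing, mul_comm] using this

lemma integral_eq_of_isSubseqWeakLimit [CompactSpace C] (hm : 0 ≤ m) {ω : Ω} {W : Measure C}
    (hW : IsSubseqWeakLimit
      (fun n => brwMeasure ι fun x => ENNReal.ofReal ((m ^ n)⁻¹ * (B n ω x : ℝ))) W)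
    {ψ : C(C, ℝ≥0)} {L : ℝ}
    (hL : Tendsto (fun n => realPairing m B (fun x => (ψ (ι x) : ℝ)) n ω) atTop (𝓝 L)) :
    ∫ c, (ψ c : ℝ) ∂W = L := by
  obtain ⟨k, hk, h⟩ := hW
  have h' := h (BoundedContinuousFunction.mkOfCompact ⟨fun c => (ψ c : ℝ), by fun_prop⟩)
  simp only [BoundedContinuousFunction.mkOfCompact_apply, ContinuousMap.coe_mk,
    integral_brwMeasure hm] at h'
  exact tendsto_nhds_unique h' (hL.comp hk.tendsto_atTop)

end WeakLimits

/-- Almost surely (w.r.t. the completion of `ℙ`; in Mathlib `∀ᵐ` applies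
the outer measure, which gives exactly this), *simultaneously* for every continuous
`φ : ∂ → [0,1]` with harmonic extension `h(x) := 𝐄ₓ[φ(X_∞)]`: the sequence `⟨h, B̄ₙ⟩`
converges, and every subsequential weak limit `W` of the random measures `B̄ₙ` satisfies
`∫_∂ φ dW = limₙ ⟨h, B̄ₙ⟩`. The exceptional null set is uniform over all such `φ`. -/
theorem brw_uniform_null_set_over_continuous_functions
    {S : Type*} [Countable S] [DecidableEq S]
    (P : S → S → ℝ)
    (hP0 : ∀ x y, 0 ≤ P x y)
    (hP1 : ∀ x, HasSum (fun y => P x y) 1)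
    (m : ℝ) (hm : 1 < m) (o : S)
    {Ω : Type*} {mΩ : MeasurableSpace Ω}
    (μ : Measure Ω) [IsProbabilityMeasure μ]
    (F : Filtration ℕ mΩ)
    (B : ℕ → Ω → S → ℕ)
    (hadapt : ∀ n x, Measurable[F n] (fun ω => B n ω x))
    (hfin : ∀ n ω, (Function.support (B n ω)).Finite)
    (hint : ∀ n x, Integrable (fun ω => (B n ω x : ℝ)) μ)
    (hB0 : ∀ ω x, B 0 ω x = if x = o then 1 else 0)
    (hbranch : ∀ n x,
      μ[fun ω => (B (n + 1) ω x : ℝ)|F n]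
        =ᵐ[μ] fun ω => m * ∑' y, (B n ω y : ℝ) * P y x)
    {C : Type*} [TopologicalSpace C] [CompactSpace C]
    [TopologicalSpace.MetrizableSpace C] [MeasurableSpace C] [BorelSpace C]
    [TopologicalSpace S] [DiscreteTopology S]
    (ι : S → C) (hι : IsOpenEmbedding ι)
    [MeasurableSpace S] [MeasurableSingletonClass S]
    (Q : S → Measure (ℕ → S))
    (hQprob : ∀ x, IsProbabilityMeasure (Q x))
    (hQcyl : ∀ (x : S) (n : ℕ) (s : ℕ → S),
      Q x {ω | ∀ i ≤ n, ω i = s i} =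
        (if s 0 = x then 1 else 0) *
          ∏ i ∈ Finset.range n, ENNReal.ofReal (P (s i) (s (i + 1))))
    (Xinf : (ℕ → S) → C)
    (hXmeas : Measurable Xinf)
    (hXconv : ∀ x : S, ∀ᵐ ω ∂(Q x),
      Xinf ω ∈ (Set.range ι)ᶜ ∧ Tendsto (fun n => ι (ω n)) atTop (𝓝 (Xinf ω)))
    :
    ∀ᵐ ω ∂μ, ∀ φ : C → ℝ, ContinuousOn φ (Set.range ι)ᶜ →
      (∀ c ∈ (Set.range ι)ᶜ, φ c ∈ Set.Icc (0 : ℝ) 1) →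
      ∃ L : ℝ,
        Tendsto
          (fun n => (m ^ n)⁻¹ * ∑' x, (∫ ω', φ (Xinf ω') ∂(Q x)) * (B n ω x : ℝ))
          atTop (𝓝 L) ∧
        ∀ W : Measure C, IsFiniteMeasure W →
          IsSubseqWeakLimit
            (fun n => brwMeasure ι fun x => ENNReal.ofReal ((m ^ n)⁻¹ * (B n ω x : ℝ))) W →
          (∫ c in (Set.range ι)ᶜ, φ c ∂W) = L := by
  have hm0 : 0 < m := by linarith
  have hlim : ∀ x : S, ∀ᵐ ω ∂(Q x), Tendsto (fun n => ι (ω n)) atTop (𝓝 (Xinf ω)) :=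
    fun x => (hXconv x).mono fun ω h => h.2
  have hbdry : ∀ x : S, ∀ᵐ ω ∂(Q x), Xinf ω ∈ (Set.range ι)ᶜ :=
    fun x => (hXconv x).mono fun ω h => h.1
  have hclosed : IsClosed (Set.range ι)ᶜ := hι.isOpen_range.isClosed_compl
  have : SecondCountableTopology C := by
    let _ := TopologicalSpace.metrizableSpaceMetric C
    infer_instance
  obtain ⟨s, hsc, hsd⟩ := TopologicalSpace.exists_countable_dense C(C, ℝ≥0)
  have hbound : ∀ (ψ : C(C, ℝ≥0)) x, ∫⁻ ω, (ψ (Xinf ω) : ℝ≥0∞) ∂(Q x) ≠ ∞ := fun ψ x => by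
    obtain ⟨K, hK⟩ := exists_forall_le_of_compact ψ
    refine ne_top_of_le_ne_top (b := (K : ℝ≥0∞)) ENNReal.coe_ne_top ?_
    refine (lintegral_mono fun ω => ENNReal.coe_le_coe.2 (hK _)).trans ?_
    simp
  have hosc : ∀ (ψ : C(C, ℝ≥0)) x, ∫⁻ ω, pathOscillation (ψ ∘ ι) ω ∂(Q x) ≠ ∞ := fun ψ x => by
    obtain ⟨K, hK⟩ := exists_forall_le_of_compact ψ
    refine ne_top_of_le_ne_top (b := (K : ℝ≥0∞)) ENNReal.coe_ne_top ?_
    refine (lintegral_mono fun ω => pathOscillation_le (fun y => hK (ι y)) ω).trans ?_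
    simp
  have hreal : ∀ (ψ : C(C, ℝ≥0)) x, (∫⁻ ω, (ψ (Xinf ω) : ℝ≥0∞) ∂(Q x)).toReal
      = ∫ ω, (ψ (Xinf ω) : ℝ) ∂(Q x) := fun ψ x => by
    rw [lintegral_coe_eq_integral _ (integrable_boundary hQprob hXmeas ψ x),
      ENNReal.toReal_ofReal (integral_nonneg fun ω => NNReal.coe_nonneg _)]
  have hone := ae_exists_tendsto_rescaledPairing hP0 hm0 hadapt hfin hint hB0 hbranch
    (v := 1) (by simp) fun x => by
      simp [transitionOp, ← ENNReal.ofReal_tsum_of_nonneg (hP0 x) (hP1 x).summable,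
        (hP1 x).tsum_eq]
  have hharm := (ae_ball_iff hsc).2 fun ψ (_ : ψ ∈ s) =>
    ae_exists_tendsto_rescaledPairing hP0 hm0 hadapt hfin hint hB0 hbranch (hbound ψ)
      (transitionOp_boundaryExtension_le hP1 hP0 hQprob hQcyl hlim ψ)
  have hpot := (ae_ball_iff hsc).2 fun ψ (_ : ψ ∈ s) =>
    ae_tendsto_zero_rescaledPairing hP0 hm0 hadapt hfin hint hB0 hbranch (hosc ψ)
      (transitionOp_lintegral_pathOscillation_le hP1 hP0 hQprob hQcyl (ψ ∘ ι))
      (tendsto_iterate_lintegral_pathOscillation hP1 hP0 hQprob hQcyl hlim ψ o)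
  filter_upwards [hone, hharm, hpot] with ω h1 h2 h3
  have key : ∀ ψ : C(C, ℝ≥0), ∃ L,
      Tendsto (fun n => realPairing m B (fun x => ∫ ω', (ψ (Xinf ω') : ℝ) ∂(Q x)) n ω)
        atTop (𝓝 L) ∧
      Tendsto (fun n => realPairing m B (fun x => (ψ (ι x) : ℝ)) n ω) atTop (𝓝 L) := by
    refine exists_common_limit_of_dense hm0.le hfin hsd
      (H := fun ψ x => ∫ ω', (ψ (Xinf ω') : ℝ) ∂(Q x)) (J := fun ψ x => (ψ (ι x) : ℝ))
      (abs_boundaryExtension_sub_le_dist hQprob hXmeas)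
      (fun ψ ψ' x => ContinuousMap.dist_apply_le_dist (f := ψ) (g := ψ') (ι x))
      (abs_boundaryExtension_sub_le hQprob hQcyl hXmeas hlim) ?_ (fun ψ hψ => ?_) fun ψ hψ => ?_
    · obtain ⟨L, hL⟩ := h1
      obtain ⟨T, hT⟩ := hL.bddAbove_range
      refine ⟨T, fun n => le_trans (le_of_eq ?_) (hT ⟨n, rfl⟩)⟩
      refine Eq.trans ?_ (toReal_rescaledPairing hm0.le (v := 1) (by simp) n ω).symm
      simp [realPairing]
    · simpa only [toReal_rescaledPairing hm0.le (hbound ψ), hreal] using h2 ψ hψ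
    · simpa only [toReal_rescaledPairing hm0.le (hosc ψ)] using h3 ψ hψ
  intro φ hφc hφ01
  obtain ⟨ψ, hψ⟩ : ∃ ψ : C(C, ℝ≥0), ∀ c ∈ (Set.range ι)ᶜ, (ψ c : ℝ) = φ c := by
    obtain ⟨g, hg⟩ := ContinuousMap.exists_restrict_eq hclosed
      (⟨_, hφc.domRestrict⟩ : C(((Set.range ι)ᶜ : Set C), ℝ))
    refine ⟨⟨fun c => (g c).toNNReal, by fun_prop⟩, fun c hc => ?_⟩
    have hgc : g c = φ c := congrArg (fun f => f ⟨c, hc⟩) hg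
    simp [hgc, (hφ01 c hc).1]
  have hext : ∀ x, ∫ ω', φ (Xinf ω') ∂(Q x) = ∫ ω', (ψ (Xinf ω') : ℝ) ∂(Q x) := fun x =>
    integral_congr_ae ((hbdry x).mono fun ω' h => (hψ _ h).symm)
  obtain ⟨L, hL, hL'⟩ := key ψ
  refine ⟨L, by simpa only [hext, realPairing] using hL, fun W _ hW => ?_⟩
  have hpoint : ∀ x, W {ι x} = 0 := fun x => by
    have hclopen : IsClopen ({ι x} : Set C) :=
      ⟨isClosed_singleton, by simpa using hι.isOpenMap {x} (isOpen_discrete _)⟩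
    let χ : C(C, ℝ≥0) := ⟨Set.indicator {ι x} 1, hclopen.continuous_indicator continuous_const⟩
    obtain ⟨L₀, h₀, h₀'⟩ := key χ
    have hz : ∀ y, ∫ ω', (χ (Xinf ω') : ℝ) ∂(Q y) = 0 := fun y => by
      refine integral_eq_zero_of_ae ((hbdry y).mono fun ω' h => ?_)
      have : Xinf ω' ≠ ι x := fun e => h ⟨x, e.symm⟩
      simp [χ, this]
    have hL₀ : L₀ = 0 := by
      simp only [hz] at h₀
      exact tendsto_nhds_unique h₀ (by simp [realPairing])
    have hint' := integral_eq_of_isSubseqWeakLimit hm0.le hW h₀'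
    have hχ : (fun c => (χ c : ℝ)) = Set.indicator {ι x} 1 := by
      funext c
      by_cases hc : c = ι x <;> simp [χ, hc]
    rw [hχ, integral_indicator_one (measurableSet_singleton _), hL₀] at hint'
    exact (measureReal_eq_zero_iff).1 hint'
  have hrange : W (Set.range ι) = 0 := by
    rw [← Set.iUnion_singleton_eq_range]
    exact measure_iUnion_null hpoint
  rw [setIntegral_congr_fun hclosed.measurableSet fun c hc => (hψ c hc).symm]
  have hae : ((Set.range ι)ᶜ : Set C) =ᵐ[W] Set.univ := by
    rw [ae_eq_univ, compl_compl]
    exact hrange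
  rw [setIntegral_congr_set hae, setIntegral_univ]
  exact integral_eq_of_isSubseqWeakLimit hm0.le hW hL'
end
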